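/- arXiv:1905.04532 — 12 statements merged into one kernel-verified Lean document; each statement's English description precedes it below -/
import Mathlib

section
/- Let A be a 2x2 zero-sum game that has a unique Nash equilibrium, and this equilibrium (x₁*, x₂*) is fully mixed. Suppose both players update their strategies by gradient descent with any fixed step size η > 0 from initial strategies (x₁⁰, x₂⁰) ≠ (x₁*, x₂*). Then there exists B ∈ ℕ such that for every t ≥ B the strategy profile xᵗ lies on the boundary of Δ × Δ, i.e., at least one of the two players plays a pure strategy (a vertex of Δ) at iteration t. -/
open Finset

/-- The probability simplex in `ℝ²`. -/
def simplex2 : Set (Fin 2 → ℝ) :=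
  {x | 0 ≤ x 0 ∧ 0 ≤ x 1 ∧ x 0 + x 1 = 1}

/-- Dot product on `ℝ²`. -/
noncomputable def dot2 (x y : Fin 2 → ℝ) : ℝ := x 0 * y 0 + x 1 * y 1

/-- The objective `y·x - ‖x‖₂²/(2η)` maximized at each gradient descent step. -/
noncomputable def gdObj (η : ℝ) (y x : Fin 2 → ℝ) : ℝ :=
  dot2 y x - (x 0 ^ 2 + x 1 ^ 2) / (2 * η)

/-- `x` is the (unique) maximizer over the simplex of `z ↦ y·z - ‖z‖₂²/(2η)`. -/
def IsGDArgmax (η : ℝ) (y x : Fin 2 → ℝ) : Prop :=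
  x ∈ simplex2 ∧ ∀ z ∈ simplex2, gdObj η y z ≤ gdObj η y x

/-- Gradient descent dynamics in the 2x2 zero-sum game `A` with step size `η`
and initial payoff vectors `y10`, `y20`. -/
structure GD2 (A : Matrix (Fin 2) (Fin 2) ℝ) (η : ℝ) (y10 y20 : Fin 2 → ℝ) where
  x1 : ℕ → Fin 2 → ℝ
  x2 : ℕ → Fin 2 → ℝ
  y1 : ℕ → Fin 2 → ℝ
  y2 : ℕ → Fin 2 → ℝ
  y1_zero : y1 0 = y10
  y2_zero : y2 0 = y20
  x1_argmax : ∀ t, IsGDArgmax η (y1 t) (x1 t)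
  x2_argmax : ∀ t, IsGDArgmax η (y2 t) (x2 t)
  y1_succ : ∀ t, y1 (t + 1) = y1 t + A.mulVec (x2 t)
  y2_succ : ∀ t, y2 (t + 1) = y2 t - A.transpose.mulVec (x1 t)

/-- `(p, q)` is a Nash equilibrium of the 2x2 zero-sum game `A`. -/
def IsNash (A : Matrix (Fin 2) (Fin 2) ℝ) (p q : Fin 2 → ℝ) : Prop :=
  p ∈ simplex2 ∧ q ∈ simplex2 ∧
  (∀ x ∈ simplex2, dot2 x (A.mulVec q) ≤ dot2 p (A.mulVec q)) ∧
  (∀ y ∈ simplex2, dot2 p (A.mulVec q) ≤ dot2 p (A.mulVec y))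

/-- A strategy is fully mixed if all its coordinates are strictly positive. -/
def FullyMixed (x : Fin 2 → ℝ) : Prop := 0 < x 0 ∧ 0 < x 1

/-- A vertex of the simplex, i.e., a pure strategy. -/
def IsVertex (x : Fin 2 → ℝ) : Prop := x = ![1, 0] ∨ x = ![0, 1]

/-- The projection of `ℝ` onto `[0, 1]`. -/
noncomputable def clamp (s : ℝ) : ℝ := max 0 (min 1 s)

lemma clamp_nonneg (s : ℝ) : 0 ≤ clamp s := le_max_left _ _

lemma clamp_le_one (s : ℝ) : clamp s ≤ 1 := max_le zero_le_one (min_le_left _ _)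

lemma continuous_clamp : Continuous clamp := by unfold clamp; fun_prop

lemma clamp_of_mem {s : ℝ} (h0 : 0 ≤ s) (h1 : s ≤ 1) : clamp s = s := by
  rw [clamp, min_eq_right h1, max_eq_right h0]

lemma clamp_cases (s : ℝ) :
    (s ≤ 0 ∧ clamp s = 0) ∨ (0 ≤ s ∧ s ≤ 1 ∧ clamp s = s) ∨ (1 ≤ s ∧ clamp s = 1) := by
  rcases le_total s 0 with h | h
  · exact .inl ⟨h, max_eq_left ((min_le_right _ _).trans h)⟩
  rcases le_total s 1 with h' | h'
  · exact .inr (.inl ⟨h, h', clamp_of_mem h h'⟩)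
  · exact .inr (.inr ⟨h', by rw [clamp, min_eq_left h', max_eq_right zero_le_one]⟩)

/-- Variational characterization of the projection onto `[0, 1]`. -/
lemma clamp_variational (s : ℝ) {c : ℝ} (h0 : 0 ≤ c) (h1 : c ≤ 1) :
    0 ≤ (clamp s - c) * (s - clamp s) := by
  rcases clamp_cases s with ⟨h, e⟩ | ⟨-, -, e⟩ | ⟨h, e⟩ <;> rw [e] <;> nlinarith

/-- A convex potential with derivative `clamp s - p`, vanishing at `p`. -/
noncomputable def potential (p s : ℝ) : ℝ :=
  (clamp s - p) ^ 2 / 2 + (clamp s - p) * (s - clamp s)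

lemma continuous_potential (p : ℝ) : Continuous (potential p) := by
  have := continuous_clamp
  unfold potential
  fun_prop

lemma le_potential {p : ℝ} (h0 : 0 ≤ p) (h1 : p ≤ 1) (s : ℝ) :
    (clamp s - p) ^ 2 / 2 ≤ potential p s := by
  have := clamp_variational s h0 h1
  unfold potential
  linarith

lemma potential_of_mem (p : ℝ) {s : ℝ} (h0 : 0 ≤ s) (h1 : s ≤ 1) :
    potential p s = (s - p) ^ 2 / 2 := by
  rw [potential, clamp_of_mem h0 h1]; ring

lemma potential_add_le (p s s' : ℝ) :
    potential p s + (clamp s - p) * (s' - s) + (clamp s' - clamp s) ^ 2 / 2 ≤ potential p s' := by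
  have := clamp_variational s' (clamp_nonneg s) (clamp_le_one s)
  unfold potential
  nlinarith

/-- The energy of the pair of unconstrained strategies. -/
noncomputable def energy (p q : ℝ) (z : ℝ × ℝ) : ℝ := potential p z.1 + potential q z.2

/-- One step of gradient descent on the pair of unconstrained strategies. -/
noncomputable def gdStep (p q k : ℝ) (z : ℝ × ℝ) : ℝ × ℝ :=
  (z.1 + k * (clamp z.2 - q), z.2 - k * (clamp z.1 - p))

lemma energy_gdStep (p q k : ℝ) (z : ℝ × ℝ) :
    energy p q z + (clamp (gdStep p q k z).1 - clamp z.1) ^ 2 / 2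
      + (clamp (gdStep p q k z).2 - clamp z.2) ^ 2 / 2 ≤ energy p q (gdStep p q k z) := by
  have h1 := potential_add_le p z.1 (gdStep p q k z).1
  have h2 := potential_add_le q z.2 (gdStep p q k z).2
  simp only [energy, gdStep] at *
  linarith

lemma energy_le_energy_gdStep (p q k : ℝ) (z : ℝ × ℝ) :
    energy p q z ≤ energy p q (gdStep p q k z) := by
  have := energy_gdStep p q k z
  have := sq_nonneg (clamp (gdStep p q k z).1 - clamp z.1)
  have := sq_nonneg (clamp (gdStep p q k z).2 - clamp z.2)
  linarith

lemma eq_one_of_clamp_add_eq {u w : ℝ} (hw : 0 < w) (h : clamp (u + w) = u) : u = 1 := by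
  rcases clamp_cases (u + w) with ⟨_, _⟩ | ⟨_, _, _⟩ | ⟨_, _⟩ <;> linarith

lemma eq_zero_of_clamp_sub_eq {u w : ℝ} (hw : 0 < w) (h : clamp (u - w) = u) : u = 0 := by
  rcases clamp_cases (u - w) with ⟨_, _⟩ | ⟨_, _, _⟩ | ⟨_, _⟩ <;> linarith

/-- The projected dynamics on the unit square has no fixed point besides the equilibrium. -/
lemma eq_equilibrium_of_fixed {p q k u v : ℝ} (hp0 : 0 < p) (hp1 : p < 1) (hq0 : 0 < q)
    (hq1 : q < 1) (hk : 0 < k) (hu : clamp (u + k * (v - q)) = u)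
    (hv : clamp (v - k * (u - p)) = v) : u = p ∧ v = q := by
  rcases lt_trichotomy v q with h | h | h
  · have hu0 : u = 0 := eq_zero_of_clamp_sub_eq (w := k * (q - v))
      (mul_pos hk (by linarith)) (by rw [← hu]; congr 1; rw [hu]; ring)
    have hv1 : v = 1 := eq_one_of_clamp_add_eq (w := k * p) (mul_pos hk hp0)
      (by rw [hu0] at hv; rw [← hv]; congr 1; rw [hv]; ring)
    linarith
  · refine ⟨?_, h⟩
    rcases lt_trichotomy u p with h' | h' | h'
    · have hv1 : v = 1 := eq_one_of_clamp_add_eq (w := k * (p - u))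
        (mul_pos hk (by linarith)) (by rw [← hv]; congr 1; rw [hv]; ring)
      linarith
    · exact h'
    · have hv0 : v = 0 := eq_zero_of_clamp_sub_eq (mul_pos hk (by linarith)) hv
      linarith
  · have hu1 : u = 1 := eq_one_of_clamp_add_eq (mul_pos hk (by linarith)) hu
    have hv0 : v = 0 := eq_zero_of_clamp_sub_eq (mul_pos hk (by linarith)) hv
    linarith

/-- Away from the equilibrium, every step from the unit square increases the energy by a definite
amount. -/
lemma exists_energy_gap {p q k : ℝ} (hp0 : 0 < p) (hp1 : p < 1) (hq0 : 0 < q) (hq1 : q < 1)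
    (hk : 0 < k) {E : ℝ} (hE : 0 < E) :
    ∃ δ > 0, ∀ z ∈ Set.Icc (0 : ℝ) 1 ×ˢ Set.Icc (0 : ℝ) 1, E ≤ energy p q z →
      energy p q z + δ ≤ energy p q (gdStep p q k z) := by
  have hcE : Continuous (energy p q) := by
    have h1 := continuous_potential p
    have h2 := continuous_potential q
    unfold energy
    fun_prop
  have hcS : Continuous (gdStep p q k) := by
    have := continuous_clamp
    unfold gdStep
    fun_prop
  have hK : IsCompact ((Set.Icc (0 : ℝ) 1 ×ˢ Set.Icc (0 : ℝ) 1) ∩ {z | E ≤ energy p q z}) :=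
    (isCompact_Icc.prod isCompact_Icc).inter_right (isClosed_le continuous_const hcE)
  obtain ⟨δ, hδ, h⟩ := hK.exists_forall_le' (a := 0)
    (f := fun z => energy p q (gdStep p q k z) - energy p q z)
    ((hcE.comp hcS).sub hcE).continuousOn (by
      rintro ⟨u, v⟩ ⟨⟨⟨hu0, hu1⟩, hv0, hv1⟩, hz⟩
      by_contra! hle
      have hs := energy_gdStep p q k (u, v)
      simp only [Set.mem_ofPred_eq] at *
      have h1 := sq_nonneg (clamp (gdStep p q k (u, v)).1 - clamp u)
      have h2 := sq_nonneg (clamp (gdStep p q k (u, v)).2 - clamp v)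
      have e1 := pow_eq_zero_iff (two_ne_zero) |>.1
        (show (clamp (gdStep p q k (u, v)).1 - clamp u) ^ 2 = 0 by linarith)
      have e2 := pow_eq_zero_iff (two_ne_zero) |>.1
        (show (clamp (gdStep p q k (u, v)).2 - clamp v) ^ 2 = 0 by linarith)
      simp only [gdStep, clamp_of_mem hu0 hu1, clamp_of_mem hv0 hv1, sub_eq_zero] at e1 e2
      obtain ⟨rfl, rfl⟩ := eq_equilibrium_of_fixed hp0 hp1 hq0 hq1 hk e1 e2
      simp only [energy, potential_of_mem _ hu0 hu1, potential_of_mem _ hv0 hv1] at hz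
      norm_num at hz
      linarith)
  refine ⟨δ, hδ, fun z hz hEz => ?_⟩
  have := h z ⟨hz, hEz⟩
  linarith

/-- The scalar dynamics eventually leaves the open unit square for good. -/
lemma gdStep_eventually_outside {p q k : ℝ} (hp0 : 0 < p) (hp1 : p < 1) (hq0 : 0 < q)
    (hq1 : q < 1) (hk : 0 < k) (P Q : ℕ → ℝ)
    (hP : ∀ t, P (t + 1) = P t + k * (clamp (Q t) - q))
    (hQ : ∀ t, Q (t + 1) = Q t - k * (clamp (P t) - p))
    (hInit : ¬(clamp (P 0) = p ∧ clamp (Q 0) = q)) :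
    ∃ B : ℕ, ∀ t ≥ B,
      (clamp (P t) = 0 ∨ clamp (P t) = 1) ∨ (clamp (Q t) = 0 ∨ clamp (Q t) = 1) := by
  set z : ℕ → ℝ × ℝ := fun t => (P t, Q t)
  have hz : ∀ t, z (t + 1) = gdStep p q k (z t) := fun t => by simp [z, gdStep, hP, hQ]
  have hmono : Monotone fun t => energy p q (z t) :=
    monotone_nat_of_le_succ fun t => by rw [hz]; exact energy_le_energy_gdStep p q k (z t)
  have hE : 0 < energy p q (z 0) := by
    have h1 := le_potential hp0.le hp1.le (P 0)
    have h2 := le_potential hq0.le hq1.le (Q 0)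
    by_contra! hle
    simp only [energy, z] at hle
    have s1 := sq_nonneg (clamp (P 0) - p)
    have s2 := sq_nonneg (clamp (Q 0) - q)
    have e1 := pow_eq_zero_iff two_ne_zero |>.1 (show (clamp (P 0) - p) ^ 2 = 0 by linarith)
    have e2 := pow_eq_zero_iff two_ne_zero |>.1 (show (clamp (Q 0) - q) ^ 2 = 0 by linarith)
    exact hInit ⟨by linarith, by linarith⟩
  obtain ⟨δ, hδ, hgap⟩ := exists_energy_gap hp0 hp1 hq0 hq1 hk hE
  by_contra! hcon
  have hvisit : ∀ B, ∃ t ≥ B, z t ∈ Set.Icc (0 : ℝ) 1 ×ˢ Set.Icc (0 : ℝ) 1 := by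
    intro B
    obtain ⟨t, ht, ⟨hP0, hP1⟩, hQ0, hQ1⟩ := hcon B
    refine ⟨t, ht, ?_, ?_⟩
    · rcases clamp_cases (P t) with ⟨_, h⟩ | ⟨h, h', _⟩ | ⟨_, h⟩
      exacts [absurd h hP0, ⟨h, h'⟩, absurd h hP1]
    · rcases clamp_cases (Q t) with ⟨_, h⟩ | ⟨h, h', _⟩ | ⟨_, h⟩
      exacts [absurd h hQ0, ⟨h, h'⟩, absurd h hQ1]
  have hgrow : ∀ n : ℕ, ∃ t, n * δ ≤ energy p q (z t) := by
    intro n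
    induction n with
    | zero => exact ⟨0, by simpa using hE.le⟩
    | succ n ih =>
      obtain ⟨t, ht⟩ := ih
      obtain ⟨s, hs, hsz⟩ := hvisit t
      refine ⟨s + 1, ?_⟩
      have h1 := hgap _ hsz (hmono s.zero_le)
      have h2 : energy p q (z t) ≤ energy p q (z s) := hmono hs
      rw [hz]
      push_cast
      linarith
  obtain ⟨n, hn⟩ := exists_nat_gt (1 / δ)
  obtain ⟨t, ht⟩ := hgrow n
  obtain ⟨s, hs, ⟨hP0, hP1⟩, hQ0, hQ1⟩ := hvisit t
  have h1 : energy p q (z t) ≤ energy p q (z s) := hmono hs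
  have h2 : energy p q (z s) ≤ 1 := by
    simp only [energy, potential_of_mem _ hP0 hP1, potential_of_mem _ hQ0 hQ1]
    nlinarith
  rw [div_lt_iff₀ hδ] at hn
  linarith

lemma IsGDArgmax.apply_zero {η : ℝ} (hη : 0 < η) {y x : Fin 2 → ℝ} (h : IsGDArgmax η y x) :
    x 0 = clamp (1 / 2 + η / 2 * (y 0 - y 1)) := by
  obtain ⟨⟨h0, h1, hs⟩, hmax⟩ := h
  set m := 1 / 2 + η / 2 * (y 0 - y 1) with hm
  have hc := hmax ![clamp m, 1 - clamp m]
    ⟨by simpa using clamp_nonneg m, by simpa using clamp_le_one m, by simp⟩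
  have hv := clamp_variational m h0 (by linarith)
  have hx : x 1 = 1 - x 0 := by linarith
  have key : ∀ u : ℝ, y 0 * u + y 1 * (1 - u) - (u ^ 2 + (1 - u) ^ 2) / (2 * η)
      = y 1 + (m ^ 2 - 1 / 2) / η - (u - m) ^ 2 / η := fun u => by
    rw [hm]; field_simp; ring
  simp only [gdObj, dot2, Matrix.cons_val_zero, Matrix.cons_val_one, hx, key] at hc
  have hd : (x 0 - m) ^ 2 ≤ (clamp m - m) ^ 2 := by
    rw [← div_le_div_iff_of_pos_right hη]; linarith
  have : (x 0 - clamp m) ^ 2 ≤ 0 := by nlinarith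
  have := pow_eq_zero_iff two_ne_zero |>.1 (le_antisymm this (sq_nonneg _))
  linarith

lemma isVertex_of_mem_simplex2 {x : Fin 2 → ℝ} (hx : x ∈ simplex2) (h : x 0 = 0 ∨ x 0 = 1) :
    IsVertex x := by
  obtain ⟨-, -, hs⟩ := hx
  rcases h with h | h
  · right; ext i; fin_cases i <;> simp <;> linarith
  · left; ext i; fin_cases i <;> simp <;> linarith

lemma pure_zero_mem_simplex2 : (![1, 0] : Fin 2 → ℝ) ∈ simplex2 := by simp [simplex2]

lemma pure_one_mem_simplex2 : (![0, 1] : Fin 2 → ℝ) ∈ simplex2 := by simp [simplex2]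

/-- Against a fully mixed equilibrium strategy, player 1 is indifferent. -/
lemma IsNash.indifferent_fst {A : Matrix (Fin 2) (Fin 2) ℝ} {p q : Fin 2 → ℝ}
    (h : IsNash A p q) (hp : FullyMixed p) :
    A 0 0 * q 0 + A 0 1 * q 1 = A 1 0 * q 0 + A 1 1 * q 1 := by
  obtain ⟨⟨-, -, hs⟩, -, h1, -⟩ := h
  have e0 := h1 _ pure_zero_mem_simplex2
  have e1 := h1 _ pure_one_mem_simplex2
  obtain ⟨hp0, hp1⟩ := hp
  simp [dot2, Matrix.mulVec, dotProduct, Fin.sum_univ_two] at e0 e1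
  have hp' : p 1 = 1 - p 0 := by linarith
  rw [hp'] at e0 e1 hp1
  apply le_antisymm
  · exact le_of_mul_le_mul_left (by linarith) hp1
  · exact le_of_mul_le_mul_left (by linarith) hp0

/-- Against a fully mixed equilibrium strategy, player 2 is indifferent. -/
lemma IsNash.indifferent_snd {A : Matrix (Fin 2) (Fin 2) ℝ} {p q : Fin 2 → ℝ}
    (h : IsNash A p q) (hq : FullyMixed q) :
    A 0 0 * p 0 + A 1 0 * p 1 = A 0 1 * p 0 + A 1 1 * p 1 := by
  obtain ⟨-, ⟨-, -, hs⟩, -, h1⟩ := h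
  have e0 := h1 _ pure_zero_mem_simplex2
  have e1 := h1 _ pure_one_mem_simplex2
  obtain ⟨hq0, hq1⟩ := hq
  simp [dot2, Matrix.mulVec, dotProduct, Fin.sum_univ_two] at e0 e1
  have hq' : q 1 = 1 - q 0 := by linarith
  rw [hq'] at e0 e1 hq1
  apply le_antisymm
  · exact le_of_mul_le_mul_left (by linarith) hq0
  · exact le_of_mul_le_mul_left (by linarith) hq1

/-- The interaction coefficient of a game with a unique, fully mixed equilibrium does not
vanish. -/
lemma interaction_ne_zero {A : Matrix (Fin 2) (Fin 2) ℝ} {p q : Fin 2 → ℝ}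
    (hNash : IsNash A p q) (hmp : FullyMixed p) (hmq : FullyMixed q)
    (hUnique : ∀ p' q', IsNash A p' q' → p' = p ∧ q' = q) :
    A 0 0 - A 0 1 - A 1 0 + A 1 1 ≠ 0 := by
  intro hD
  have e1 := hNash.indifferent_fst hmp
  have e2 := hNash.indifferent_snd hmq
  have hp : p 1 = 1 - p 0 := by linarith [hNash.1.2.2]
  have hq : q 1 = 1 - q 0 := by linarith [hNash.2.1.2.2]
  rw [hq] at e1
  rw [hp] at e2
  have h01 : A 0 1 = A 1 1 := by linear_combination e1 - q 0 * hD
  have h10 : A 1 0 = A 1 1 := by linear_combination e2 - p 0 * hD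
  have h00 : A 0 0 = A 1 1 := by linarith
  have hval : ∀ x ∈ simplex2, ∀ y ∈ simplex2, dot2 x (A.mulVec y) = A 1 1 := by
    rintro x ⟨-, -, hx⟩ y ⟨-, -, hy⟩
    simp only [dot2, Matrix.mulVec, dotProduct, Fin.sum_univ_two, h00, h01, h10]
    linear_combination A 1 1 * (y 0 + y 1) * hx + A 1 1 * hy
  have hpure := pure_zero_mem_simplex2
  have := (hUnique ![1, 0] ![1, 0] ⟨hpure, hpure,
    fun x hx => by rw [hval x hx _ hpure, hval _ hpure _ hpure],
    fun y hy => by rw [hval _ hpure y hy, hval _ hpure _ hpure]⟩).1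
  have h := hmp.2
  simp [← this] at h

/-- if the 2x2 zero-sum game `A` has a unique Nash equilibrium, which is
fully mixed, then for any step size `η > 0` and any initial condition with
`(x₁⁰, x₂⁰) ≠ (x₁*, x₂*)`, eventually at least one player plays a pure strategy forever. -/
theorem boundary_convergence (A : Matrix (Fin 2) (Fin 2) ℝ) (p q : Fin 2 → ℝ)
    (hNash : IsNash A p q) (hmp : FullyMixed p) (hmq : FullyMixed q)
    (hUnique : ∀ p' q', IsNash A p' q' → p' = p ∧ q' = q)
    (η : ℝ) (hη : 0 < η) (y10 y20 : Fin 2 → ℝ) (g : GD2 A η y10 y20)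
    (hInit : ¬(g.x1 0 = p ∧ g.x2 0 = q)) :
    ∃ B : ℕ, ∀ t ≥ B, IsVertex (g.x1 t) ∨ IsVertex (g.x2 t) := by
  set D := A 0 0 - A 0 1 - A 1 0 + A 1 1 with hD
  have hD0 : D ≠ 0 := interaction_ne_zero hNash hmp hmq hUnique
  have e1 := hNash.indifferent_fst hmp
  have e2 := hNash.indifferent_snd hmq
  have hp : p 1 = 1 - p 0 := by linarith [hNash.1.2.2]
  have hq : q 1 = 1 - q 0 := by linarith [hNash.2.1.2.2]
  set P : ℕ → ℝ := fun t => 1 / 2 + η / 2 * (g.y1 t 0 - g.y1 t 1) with hPdef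
  set Q : ℕ → ℝ := fun t => 1 / 2 + η / 2 * (g.y2 t 0 - g.y2 t 1) with hQdef
  have hx1 : ∀ t, g.x1 t 0 = clamp (P t) := fun t => (g.x1_argmax t).apply_zero hη
  have hx2 : ∀ t, g.x2 t 0 = clamp (Q t) := fun t => (g.x2_argmax t).apply_zero hη
  have hP : ∀ t, P (t + 1) = P t + η / 2 * D * (clamp (Q t) - q 0) := by
    intro t
    have hs : g.x2 t 1 = 1 - g.x2 t 0 := by linarith [(g.x2_argmax t).1.2.2]
    rw [hq] at e1
    simp only [hPdef, g.y1_succ, Pi.add_apply, Matrix.mulVec, dotProduct, Fin.sum_univ_two, hs,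
      ← hx2, hD]
    linear_combination (η / 2) * e1
  have hQ : ∀ t, Q (t + 1) = Q t - η / 2 * D * (clamp (P t) - p 0) := by
    intro t
    have hs : g.x1 t 1 = 1 - g.x1 t 0 := by linarith [(g.x1_argmax t).1.2.2]
    rw [hp] at e2
    simp only [hQdef, g.y2_succ, Pi.sub_apply, Matrix.mulVec, dotProduct, Fin.sum_univ_two, hs,
      Matrix.transpose_apply, ← hx1, hD]
    linear_combination -(η / 2) * e2
  have hInit' : ¬(clamp (P 0) = p 0 ∧ clamp (Q 0) = q 0) := by
    rintro ⟨h1, h2⟩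
    rw [← hx1] at h1
    rw [← hx2] at h2
    refine hInit ⟨?_, ?_⟩
    · ext i; fin_cases i
      · exact h1
      · change g.x1 0 1 = p 1
        linarith [(g.x1_argmax 0).1.2.2]
    · ext i; fin_cases i
      · exact h2
      · change g.x2 0 1 = q 1
        linarith [(g.x2_argmax 0).1.2.2]
  have hp1 : p 0 < 1 := by linarith [hmp.2]
  have hq1 : q 0 < 1 := by linarith [hmq.2]
  have main : ∃ B : ℕ, ∀ t ≥ B,
      (clamp (P t) = 0 ∨ clamp (P t) = 1) ∨ (clamp (Q t) = 0 ∨ clamp (Q t) = 1) := by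
    rcases lt_or_gt_of_ne hD0 with hneg | hpos
    · -- exchanging the two players changes the sign of the step
      obtain ⟨B, hB⟩ := gdStep_eventually_outside (k := -(η / 2 * D)) hmq.1 hq1 hmp.1 hp1
        (by nlinarith) Q P (fun t => by rw [hQ]; ring) (fun t => by rw [hP]; ring)
        (fun h => hInit' h.symm)
      exact ⟨B, fun t ht => (hB t ht).symm⟩
    · exact gdStep_eventually_outside hmp.1 hp1 hmq.1 hq1 (by positivity) P Q hP hQ hInit'
  obtain ⟨B, hB⟩ := main
  refine ⟨B, fun t ht => (hB t ht).imp (fun h => ?_) fun h => ?_⟩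
  · exact isVertex_of_mem_simplex2 (g.x1_argmax t).1 (by rwa [hx1])
  · exact isVertex_of_mem_simplex2 (g.x2_argmax t).1 (by rwa [hx2])
end

section
/- Let A be a 2x2 zero-sum game that has a unique Nash equilibrium, and this equilibrium is fully mixed. For any fixed step size η > 0 and any initial payoff vectors, if both players update their strategies by gradient descent, then there exists a constant C > 0 (depending on A, η, and the initial condition but not on T) such that Regret₁(T) ≤ C·√T for all T ≥ 1. -/
open Finset

/-- Player 1's regret after `T` iterations. -/
noncomputable def regret1 (A : Matrix (Fin 2) (Fin 2) ℝ) (x1 x2 : ℕ → Fin 2 → ℝ) (T : ℕ) : ℝ :=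
  sSup ((fun x => ∑ t ∈ Finset.range (T + 1), dot2 x (A.mulVec (x2 t))) '' simplex2)
    - ∑ t ∈ Finset.range (T + 1), dot2 (x1 t) (A.mulVec (x2 t))

/-- `x` maximizes the regularized linear payoff `z ↦ U z - c z²` over the interval `[-p, 1 - p]`. -/
def IsRegMax (c p U x : ℝ) : Prop :=
  -p ≤ x ∧ x ≤ 1 - p ∧ ∀ z, -p ≤ z → z ≤ 1 - p → U * z - c * z ^ 2 ≤ U * x - c * x ^ 2

namespace IsRegMax

variable {c p U V x y : ℝ}

theorem abs_le_one (h : IsRegMax c p U x) (hp0 : 0 < p) (hp1 : p < 1) : |x| ≤ 1 :=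
  abs_le.2 ⟨by linarith [h.1], by linarith [h.2.1]⟩

theorem abs_sub_le_one (h : IsRegMax c p U x) (h' : IsRegMax c p V y) : |y - x| ≤ 1 :=
  abs_le.2 ⟨by linarith [h.2.1, h'.1], by linarith [h.1, h'.2.1]⟩

theorem sq_le (h : IsRegMax c p U x) (hp0 : 0 < p) (hp1 : p < 1) : c * x ^ 2 ≤ U * x := by
  have := h.2.2 0 (by linarith) (by linarith)
  linarith

/-- The optimal value is a convex function of `U` with subgradient `x`. -/
theorem energy_sub_le (h : IsRegMax c p U x) (h' : IsRegMax c p V y) :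
    (V * y - c * y ^ 2) - (U * x - c * x ^ 2) ≤ y * (V - U) := by
  have := h.2.2 y h'.1 h'.2.1
  linarith

theorem monotone (hc : 0 < c) (h : IsRegMax c p U x) (h' : IsRegMax c p V y) :
    2 * c * (y - x) ^ 2 ≤ (V - U) * (y - x) := by
  have key : ∀ {U x z : ℝ}, IsRegMax c p U x → -p ≤ z → z ≤ 1 - p →
      c * (z - x) ^ 2 ≤ (U * x - c * x ^ 2) - (U * z - c * z ^ 2) := by
    intro U x z hx hz0 hz1
    -- First-order optimality, obtained by testing points on the segment from `x` to `z`.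
    have first : U * (z - x) - 2 * c * x * (z - x) ≤ 0 := by
      by_contra! hpos
      set s := U * (z - x) - 2 * c * x * (z - x) with hs
      set d := c * (z - x) ^ 2 with hd
      have hd0 : 0 ≤ d := by positivity
      set r := s / (s + d + 1) with hr
      have hden : 0 < s + d + 1 := by linarith
      have hr0 : 0 < r := div_pos hpos hden
      have hrs : r * (s + d + 1) = s := div_mul_cancel₀ _ hden.ne'
      have hr1 : r ≤ 1 := by rw [hr, div_le_one hden]; linarith
      have := hx.2.2 (x + r * (z - x)) (by nlinarith [hx.1]) (by nlinarith [hx.2.1])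
      have h2 : r * (s - r * d) ≤ 0 := by rw [hs, hd]; nlinarith
      have h3 : 0 < s - r * d := by nlinarith
      nlinarith
    nlinarith
  have h1 := key h h'.1 h'.2.1
  have h2 := key h' h.1 h.2.1
  nlinarith

theorem abs_mul_le (h : IsRegMax c p U x) (hc : 0 < c) :
    min p (1 - p) * |U| ≤ U * x - c * x ^ 2 + c * max (p ^ 2) ((1 - p) ^ 2) := by
  have hx := h.1.trans h.2.1
  have h1 := h.2.2 (-p) le_rfl hx
  have h2 := h.2.2 (1 - p) hx le_rfl
  have m1 := mul_le_mul_of_nonneg_left (le_max_left (p ^ 2) ((1 - p) ^ 2)) hc.le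
  have m2 := mul_le_mul_of_nonneg_left (le_max_right (p ^ 2) ((1 - p) ^ 2)) hc.le
  rcases le_total 0 U with hU | hU
  · rw [abs_of_nonneg hU]
    nlinarith [mul_le_mul_of_nonneg_right (min_le_right p (1 - p)) hU]
  · rw [abs_of_nonpos hU]
    nlinarith [mul_le_mul_of_nonneg_right (min_le_left p (1 - p)) (neg_nonneg.2 hU)]

theorem eq_right_of_lt (h : IsRegMax c p U x) (hc : 0 < c) (hp0 : 0 < p) (hU : 2 * c < U) :
    x = 1 - p := by
  by_contra hne
  have hlt : 0 < 1 - p - x := sub_pos.2 (lt_of_le_of_ne h.2.1 hne)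
  have := h.2.2 (1 - p) (by linarith [h.1, h.2.1]) le_rfl
  have h1 : (1 - p - x) * (U - c * (1 - p + x)) ≤ 0 := by nlinarith
  have h2 : 0 < U - c * (1 - p + x) := by nlinarith [h.2.1]
  nlinarith

theorem eq_left_of_lt (h : IsRegMax c p U x) (hc : 0 < c) (hp1 : p < 1) (hU : U < -(2 * c)) :
    x = -p := by
  by_contra hne
  have hlt : 0 < x + p := by
    have := lt_of_le_of_ne h.1 (Ne.symm hne)
    linarith
  have := h.2.2 (-p) le_rfl (by linarith [h.1, h.2.1])
  have h1 : (x + p) * (-U - c * (p - x)) ≤ 0 := by nlinarith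
  have h2 : 0 < -U - c * (p - x) := by nlinarith [h.1]
  nlinarith

/-- The maximizer only moves while the dual variable stays bounded. -/
theorem abs_mul_abs_sub_le {δ : ℝ} (h : IsRegMax c p U x) (h' : IsRegMax c p V y) (hc : 0 < c)
    (hp0 : 0 < p) (hp1 : p < 1) (hδ : |V - U| ≤ δ) : |U| * |y - x| ≤ 2 * c + δ := by
  have hδ' := abs_le.1 hδ
  have hδ0 := (abs_nonneg _).trans hδ
  rcases le_or_gt |U| (2 * c + δ) with hU | hU
  · nlinarith [abs_nonneg U, abs_nonneg (y - x), h.abs_sub_le_one h']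
  · have hxy : x = y := by
      rcases lt_abs.1 hU with hU | hU
      · rw [h.eq_right_of_lt hc hp0 (by linarith), h'.eq_right_of_lt hc hp0 (by linarith)]
      · rw [h.eq_left_of_lt hc hp1 (by linarith), h'.eq_left_of_lt hc hp1 (by linarith)]
    simp [hxy]
    linarith

/-- A dual step `-k x` for the opponent moves the opponent's maximizer against `k U`. -/
theorem mul_sub_eq_neg_abs {q W W' z z' k : ℝ} (h : IsRegMax c p U x) (hc : 0 < c) (hp0 : 0 < p)
    (hp1 : p < 1) (hz : IsRegMax c q W z) (hz' : IsRegMax c q W' z') (hW : W' = W - k * x) :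
    k * U * (z' - z) = -(|k| * (|U| * |z' - z|)) := by
  have hm := monotone hc hz hz'
  have hsq := h.sq_le hp0 hp1
  have hneg : k * (z' - z) * x ≤ 0 := by
    have : 0 ≤ 2 * c * (z' - z) ^ 2 := by positivity
    rw [hW] at hm
    nlinarith
  rw [← abs_mul, ← abs_mul, ← abs_neg]
  have hU : k * U * (z' - z) ≤ 0 := by
    rcases lt_trichotomy x 0 with hx | hx | hx
    · have h1 : U ≤ 0 := by nlinarith [mul_pos hc (mul_pos_of_neg_of_neg hx hx)]
      have h2 : 0 ≤ k * (z' - z) := by nlinarith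
      nlinarith
    · have : z' - z = 0 := by
        rw [hW, hx] at hm
        have : (z' - z) ^ 2 ≤ 0 := by nlinarith [sq_nonneg (z' - z)]
        exact pow_eq_zero_iff two_ne_zero |>.1 (le_antisymm this (sq_nonneg _))
      simp [this]
    · have h1 : 0 ≤ U := by nlinarith [mul_pos hc (mul_pos hx hx)]
      have h2 : k * (z' - z) ≤ 0 := by nlinarith
      nlinarith
  rw [abs_of_nonneg (by nlinarith)]
  ring

end IsRegMax

/-- One step of the dynamics raises the squared energy plus a rotation term by at most a
constant. -/
theorem potential_step {c p q k U W U' W' x y x' y' : ℝ} (hc : 0 < c)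
    (hp0 : 0 < p) (hp1 : p < 1) (hq0 : 0 < q) (hq1 : q < 1)
    (hx : IsRegMax c p U x) (hy : IsRegMax c q W y)
    (hx' : IsRegMax c p U' x') (hy' : IsRegMax c q W' y')
    (hU : U' = U + k * y) (hW : W' = W - k * x) :
    ((U' * x' - c * x' ^ 2) + (W' * y' - c * y' ^ 2)) ^ 2 + 2 * (k * (U' * y' - W' * x')) ≤
      ((U * x - c * x ^ 2) + (W * y - c * y ^ 2)) ^ 2 + 2 * (k * (U * y - W * x))
        + (4 * |k| * (2 * c + |k|) + 8 * k ^ 2) := by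
  have ax := hx.abs_le_one hp0 hp1
  have ay := hy.abs_le_one hq0 hq1
  have ax' := hx'.abs_le_one hp0 hp1
  have ay' := hy'.abs_le_one hq0 hq1
  have hk := abs_nonneg k
  have hk2 := sq_abs k
  have eU := hx.mul_sub_eq_neg_abs hc hp0 hp1 hy hy' hW
  have eW := hy.mul_sub_eq_neg_abs (k := -k) hc hq0 hq1 hx hx' (by rw [hU]; ring)
  rw [abs_neg] at eW
  have bU := hx.abs_mul_abs_sub_le (δ := |k|) hx' hc hp0 hp1 (by
    rw [hU, add_sub_cancel_left, abs_mul]; exact mul_le_of_le_one_right hk ay)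
  have bW := hy.abs_mul_abs_sub_le (δ := |k|) hy' hc hq0 hq1 (by
    rw [hW, sub_sub_cancel_left, abs_neg, abs_mul]; exact mul_le_of_le_one_right hk ax)
  have dx := hx.abs_sub_le_one hx'
  have dy := hy.abs_sub_le_one hy'
  have sx' := hx'.sq_le hp0 hp1
  have sy' := hy'.sq_le hq0 hq1
  have sx := hx.sq_le hp0 hp1
  have sy := hy.sq_le hq0 hq1
  have e1 := hx.energy_sub_le hx'
  have e2 := hy.energy_sub_le hy'
  have ux : U * x ≤ |U| := (le_abs_self _).trans (by
    rw [abs_mul]; exact mul_le_of_le_one_right (abs_nonneg _) ax)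
  have wy : W * y ≤ |W| := (le_abs_self _).trans (by
    rw [abs_mul]; exact mul_le_of_le_one_right (abs_nonneg _) ay)
  have hstep : x' * (U' - U) + y' * (W' - W) ≤ |k| * (|x' - x| + |y' - y|) := by
    have : x' * (U' - U) + y' * (W' - W) = k * ((x' - x) * y - (y' - y) * x) := by
      rw [hU, hW]; ring
    rw [this]
    refine (le_abs_self _).trans ?_
    rw [abs_mul]
    refine mul_le_mul_of_nonneg_left ((abs_sub _ _).trans ?_) hk
    rw [abs_mul, abs_mul]
    exact add_le_add (mul_le_of_le_one_right (abs_nonneg _) ay)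
      (mul_le_of_le_one_right (abs_nonneg _) ax)
  have hrot : k * (U' * y' - W' * x') - k * (U * y - W * x) ≤
      -(|k| * (|U| * |y' - y|)) - |k| * (|W| * |x' - x|) + 2 * k ^ 2 := by
    have : k * (U' * y' - W' * x') - k * (U * y - W * x) =
        k * U * (y' - y) + -k * W * (x' - x) + k ^ 2 * (y * y' + x * x') := by
      rw [hU, hW]; ring
    rw [this, eU, eW]
    have h1 : y * y' ≤ 1 := (le_abs_self _).trans (by
      rw [abs_mul]; exact mul_le_one₀ ay (abs_nonneg _) ay')
    have h2 : x * x' ≤ 1 := (le_abs_self _).trans (by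
      rw [abs_mul]; exact mul_le_one₀ ax (abs_nonneg _) ax')
    have h3 : k ^ 2 * (y * y' + x * x') ≤ k ^ 2 * 2 :=
      mul_le_mul_of_nonneg_left (by linarith) (sq_nonneg k)
    linarith
  have c0 : 0 ≤ c * x ^ 2 := by positivity
  have c1 : 0 ≤ c * y ^ 2 := by positivity
  have hD0 : 0 ≤ |x' - x| + |y' - y| := by positivity
  have hD2 : |x' - x| + |y' - y| ≤ 2 := by linarith
  have hUW : (|U| + |W|) * (|x' - x| + |y' - y|) ≤
      |U| * |y' - y| + |W| * |x' - x| + 2 * (2 * c + |k|) := by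
    rw [add_mul, mul_add, mul_add]
    linarith
  generalize hH : (U * x - c * x ^ 2) + (W * y - c * y ^ 2) = H at *
  generalize hH' : (U' * x' - c * x' ^ 2) + (W' * y' - c * y' ^ 2) = H' at *
  generalize hD : |x' - x| + |y' - y| = D at *
  have hH'0 : 0 ≤ H' := by linarith
  have hH0 : 0 ≤ H := by linarith
  have hHle : H ≤ |U| + |W| := by linarith
  have hinc : H' ≤ H + |k| * D := by linarith
  have hsq : H' ^ 2 ≤ (H + |k| * D) ^ 2 := pow_le_pow_left₀ hH'0 hinc 2
  have hHD : |k| * (H * D) ≤ |k| * (|U| * |y' - y| + |W| * |x' - x| + 2 * (2 * c + |k|)) :=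
    mul_le_mul_of_nonneg_left ((mul_le_mul_of_nonneg_right hHle hD0).trans hUW) hk
  have hDsq : k ^ 2 * D ^ 2 ≤ k ^ 2 * 4 :=
    mul_le_mul_of_nonneg_left (by nlinarith) (sq_nonneg k)
  have hexp : (H + |k| * D) ^ 2 = H ^ 2 + 2 * (|k| * (H * D)) + k ^ 2 * D ^ 2 := by
    rw [← hk2]; ring
  rw [hexp] at hsq
  linarith

theorem energy_le_sqrt {c p q k : ℝ} {U W x y : ℕ → ℝ} (hc : 0 < c)
    (hp0 : 0 < p) (hp1 : p < 1) (hq0 : 0 < q) (hq1 : q < 1)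
    (hx : ∀ t, IsRegMax c p (U t) (x t)) (hy : ∀ t, IsRegMax c q (W t) (y t))
    (hU : ∀ t, U (t + 1) = U t + k * y t) (hW : ∀ t, W (t + 1) = W t - k * x t) :
    ∃ C : ℝ, 0 ≤ C ∧ ∀ T : ℕ, 1 ≤ T →
      (U T * x T - c * x T ^ 2) + (W T * y T - c * y T ^ 2) ≤ C * Real.sqrt T := by
  set H : ℕ → ℝ := fun t => (U t * x t - c * x t ^ 2) + (W t * y t - c * y t ^ 2) with hHdef
  set G : ℕ → ℝ := fun t => k * (U t * y t - W t * x t) with hGdef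
  set K := 4 * |k| * (2 * c + |k|) + 8 * k ^ 2 with hK
  have hK0 : 0 ≤ K := by positivity
  have hF : ∀ T : ℕ, H T ^ 2 + 2 * G T ≤ H 0 ^ 2 + 2 * G 0 + K * T := by
    intro T
    induction T with
    | zero => simp
    | succ T ih =>
      have := potential_step hc hp0 hp1 hq0 hq1 (hx T) (hy T) (hx (T + 1)) (hy (T + 1)) (hU T) (hW T)
      push_cast
      simp only [hHdef, hGdef] at ih ⊢
      linarith
  set m := min (min p (1 - p)) (min q (1 - q)) with hm
  have hm0 : 0 < m := lt_min (lt_min hp0 (by linarith)) (lt_min hq0 (by linarith))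
  have hmax : ∀ {p : ℝ}, 0 < p → p < 1 → c * max (p ^ 2) ((1 - p) ^ 2) ≤ c := by
    intro p h0 h1
    have : max (p ^ 2) ((1 - p) ^ 2) ≤ 1 := max_le (by nlinarith) (by nlinarith)
    nlinarith
  set b := 2 * |k| / m with hb
  have hb0 : 0 ≤ b := by positivity
  have hG : ∀ t, -(b * (H t + 2 * c)) ≤ 2 * G t := by
    intro t
    have h1 := (hx t).abs_mul_le hc
    have h2 := (hy t).abs_mul_le hc
    have h1' : m * |U t| ≤ min p (1 - p) * |U t| :=
      mul_le_mul_of_nonneg_right (min_le_left _ _) (abs_nonneg _)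
    have h2' : m * |W t| ≤ min q (1 - q) * |W t| :=
      mul_le_mul_of_nonneg_right (min_le_right _ _) (abs_nonneg _)
    have h3 : m * (|U t| + |W t|) ≤ H t + 2 * c := by
      have := hmax hp0 hp1
      have := hmax hq0 hq1
      simp only [hHdef]
      linarith
    have h4 : |G t| ≤ |k| * (|U t| + |W t|) := by
      simp only [hGdef, abs_mul]
      refine mul_le_mul_of_nonneg_left ((abs_sub _ _).trans ?_) (abs_nonneg k)
      rw [abs_mul, abs_mul]
      nlinarith [abs_nonneg (U t), abs_nonneg (W t), (hx t).abs_le_one hp0 hp1,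
        (hy t).abs_le_one hq0 hq1]
    have h5 : b * (m * (|U t| + |W t|)) ≤ b * (H t + 2 * c) := mul_le_mul_of_nonneg_left h3 hb0
    have h6 : b * (m * (|U t| + |W t|)) = 2 * (|k| * (|U t| + |W t|)) := by
      rw [hb]; field_simp
    linarith [neg_abs_le (G t)]
  set a := |H 0 ^ 2 + 2 * G 0| + 2 * b * c + K with ha
  have ha0 : 0 ≤ a := by positivity
  refine ⟨Real.sqrt (2 * a + b ^ 2), Real.sqrt_nonneg _, fun T hT => ?_⟩
  have hT' : (1 : ℝ) ≤ T := by exact_mod_cast hT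
  rw [← Real.sqrt_mul (by positivity)]
  refine Real.le_sqrt_of_sq_le ?_
  change H T ^ 2 ≤ _
  have h1 := hF T
  have h2 := hG T
  have h3 := le_abs_self (H 0 ^ 2 + 2 * G 0)
  have h4 : (|H 0 ^ 2 + 2 * G 0| + 2 * b * c) * 1 ≤ (|H 0 ^ 2 + 2 * G 0| + 2 * b * c) * T :=
    mul_le_mul_of_nonneg_left hT' (by positivity)
  have h5 : H T ^ 2 ≤ a * T + b * H T := by rw [ha]; linarith
  nlinarith [sq_nonneg (H T - b), sq_nonneg b]

theorem linear_regret_le_sqrt {c p q k : ℝ} {U W x y : ℕ → ℝ} (hc : 0 < c)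
    (hp0 : 0 < p) (hp1 : p < 1) (hq0 : 0 < q) (hq1 : q < 1)
    (hx : ∀ t, IsRegMax c p (U t) (x t)) (hy : ∀ t, IsRegMax c q (W t) (y t))
    (hU : ∀ t, U (t + 1) = U t + k * y t) (hW : ∀ t, W (t + 1) = W t - k * x t) :
    ∃ C : ℝ, 0 < C ∧ ∀ T : ℕ, 1 ≤ T → ∀ z, -p ≤ z → z ≤ 1 - p →
      ∑ t ∈ range (T + 1), (z - x t) * (k * y t) ≤ C * Real.sqrt T := by
  obtain ⟨C, hC0, hC⟩ := energy_le_sqrt hc hp0 hp1 hq0 hq1 hx hy hU hW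
  refine ⟨2 * C + c + |U 0|, by positivity, fun T hT z hz0 hz1 => ?_⟩
  have hsum : ∀ n : ℕ, ∑ t ∈ range n, (z - x t) * (k * y t) ≤
      z * (U n - U 0) + ((W n * y n - c * y n ^ 2) - (W 0 * y 0 - c * y 0 ^ 2)) := by
    intro n
    induction n with
    | zero => simp
    | succ n ih =>
      rw [sum_range_succ]
      have := (hy (n + 1)).energy_sub_le (hy n)
      rw [hW n] at this ⊢
      rw [hU n]
      nlinarith
  have h1 := hsum (T + 1)
  have h2 := (hx (T + 1)).2.2 z hz0 hz1
  have h3 := hC (T + 1) (by omega)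
  have h4 := (hy 0).sq_le hq0 hq1
  have hz : |z| ≤ 1 := abs_le.2 ⟨by linarith, by linarith⟩
  have h5 : -(z * U 0) ≤ |U 0| := (neg_le_abs _).trans (by
    rw [abs_mul]; nlinarith [abs_nonneg (U 0)])
  have h6 : c * z ^ 2 ≤ c := by
    have : z ^ 2 ≤ 1 := by rw [← sq_abs]; nlinarith [abs_nonneg z]
    nlinarith
  have hT' : (1 : ℝ) ≤ T := by exact_mod_cast hT
  have h7 : (1 : ℝ) ≤ Real.sqrt T := Real.one_le_sqrt.2 hT'
  have h8 : Real.sqrt ((T + 1 : ℕ) : ℝ) ≤ 2 * Real.sqrt T := by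
    rw [Real.sqrt_le_left (by positivity), mul_pow, Real.sq_sqrt (by positivity)]
    push_cast
    linarith
  have h9 : C * Real.sqrt ((T + 1 : ℕ) : ℝ) ≤ C * (2 * Real.sqrt T) :=
    mul_le_mul_of_nonneg_left h8 hC0
  have h10 : (c + |U 0|) * 1 ≤ (c + |U 0|) * Real.sqrt T :=
    mul_le_mul_of_nonneg_left h7 (by positivity)
  linarith

theorem IsGDArgmax.isRegMax {η : ℝ} {y x : Fin 2 → ℝ} (hη : 0 < η) (h : IsGDArgmax η y x)
    (p : ℝ) : IsRegMax (1 / η) p (y 0 - y 1 - (2 * p - 1) / η) (x 0 - p) := by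
  obtain ⟨⟨h0, h1, h2⟩, hopt⟩ := h
  refine ⟨by linarith, by linarith, fun z hz0 hz1 => ?_⟩
  have := hopt ![z + p, 1 - (z + p)] ⟨by simp; linarith, by simp; linarith, by simp⟩
  have hx1 : x 1 = 1 - x 0 := by linarith
  simp only [gdObj, dot2, Matrix.cons_val_zero, Matrix.cons_val_one, hx1] at this
  have e : ∀ s : ℝ, (y 0 - y 1 - (2 * p - 1) / η) * (s - p) - 1 / η * (s - p) ^ 2 =
      y 0 * s + y 1 * (1 - s) - (s ^ 2 + (1 - s) ^ 2) / (2 * η)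
        + ((p ^ 2 - p + 1 / 2) / η - p * (y 0 - y 1) - y 1) := by
    intro s
    field_simp
    ring
  have ez := e (z + p)
  rw [add_sub_cancel_right] at ez
  rw [ez, e (x 0)]
  linarith

theorem IsNash.payoff_eq {A : Matrix (Fin 2) (Fin 2) ℝ} {p q : Fin 2 → ℝ} (h : IsNash A p q)
    (hp : FullyMixed p) : A.mulVec q 0 = A.mulVec q 1 := by
  obtain ⟨⟨_, _, hs⟩, _, hopt, _⟩ := h
  have h0 := hopt ![1, 0] ⟨by simp, by simp, by simp⟩
  have h1 := hopt ![0, 1] ⟨by simp, by simp, by simp⟩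
  simp only [dot2, Matrix.cons_val_zero, Matrix.cons_val_one] at h0 h1
  have hp1 : p 1 = 1 - p 0 := by linarith
  obtain ⟨ha, hb⟩ := hp
  rw [hp1] at h0 h1 hb
  apply le_antisymm <;> nlinarith

theorem IsNash.payoff_transpose_eq {A : Matrix (Fin 2) (Fin 2) ℝ} {p q : Fin 2 → ℝ}
    (h : IsNash A p q) (hq : FullyMixed q) :
    A.transpose.mulVec p 0 = A.transpose.mulVec p 1 := by
  obtain ⟨_, ⟨_, _, hs⟩, _, hopt⟩ := h
  have h0 := hopt ![1, 0] ⟨by simp, by simp, by simp⟩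
  have h1 := hopt ![0, 1] ⟨by simp, by simp, by simp⟩
  have hq1 : q 1 = 1 - q 0 := by linarith
  obtain ⟨ha, hb⟩ := hq
  simp only [dot2, Matrix.mulVec, dotProduct, Fin.sum_univ_two, Matrix.transpose_apply,
    Matrix.cons_val_zero, Matrix.cons_val_one, hq1] at h0 h1 hb ⊢
  apply le_antisymm <;> nlinarith

/-- gradient descent with any fixed step size in a 2x2 zero-sum game with a
unique, fully mixed Nash equilibrium has regret at most `C·√T`. -/
theorem regret_sqrt_upper (A : Matrix (Fin 2) (Fin 2) ℝ) (p q : Fin 2 → ℝ)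
    (hNash : IsNash A p q) (hmp : FullyMixed p) (hmq : FullyMixed q)
    (hUnique : ∀ p' q', IsNash A p' q' → p' = p ∧ q' = q)
    (η : ℝ) (hη : 0 < η) (y10 y20 : Fin 2 → ℝ) (g : GD2 A η y10 y20) :
    ∃ C : ℝ, 0 < C ∧ ∀ T : ℕ, 1 ≤ T → regret1 A g.x1 g.x2 T ≤ C * Real.sqrt T := by
  obtain ⟨⟨_, _, hps⟩, ⟨_, _, hqs⟩, -, -⟩ := id hNash
  have hAq := hNash.payoff_eq hmp
  have hAp := hNash.payoff_transpose_eq hmq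
  set k := A 0 0 - A 1 0 - (A 0 1 - A 1 1) with hk
  have hp1 : p 1 = 1 - p 0 := by linarith
  have hq1 : q 1 = 1 - q 0 := by linarith
  simp only [Matrix.mulVec, dotProduct, Fin.sum_univ_two, Matrix.transpose_apply, hp1, hq1]
    at hAq hAp
  have hx2 : ∀ t, g.x2 t 1 = 1 - g.x2 t 0 := fun t => by linarith [(g.x2_argmax t).1.2.2]
  have hx1 : ∀ t, g.x1 t 1 = 1 - g.x1 t 0 := fun t => by linarith [(g.x1_argmax t).1.2.2]
  have hgap : ∀ t, A.mulVec (g.x2 t) 0 - A.mulVec (g.x2 t) 1 = k * (g.x2 t 0 - q 0) := by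
    intro t
    simp only [Matrix.mulVec, dotProduct, Fin.sum_univ_two, hx2]
    linear_combination hAq
  have hgap' : ∀ t, A.transpose.mulVec (g.x1 t) 0 - A.transpose.mulVec (g.x1 t) 1 =
      k * (g.x1 t 0 - p 0) := by
    intro t
    simp only [Matrix.mulVec, dotProduct, Fin.sum_univ_two, Matrix.transpose_apply, hx1]
    linear_combination hAp
  obtain ⟨C, hC0, hC⟩ := linear_regret_le_sqrt (k := k) (one_div_pos.2 hη) hmp.1
    (by linarith [hmp.2]) hmq.1 (by linarith [hmq.2])
    (fun t => (g.x1_argmax t).isRegMax hη (p 0)) (fun t => (g.x2_argmax t).isRegMax hη (q 0))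
    (fun t => by
      rw [g.y1_succ, Pi.add_apply, Pi.add_apply]
      linear_combination hgap t)
    (fun t => by
      rw [g.y2_succ, Pi.sub_apply, Pi.sub_apply]
      linear_combination -hgap' t)
  refine ⟨C, hC0, fun T hT => ?_⟩
  rw [regret1, sub_le_iff_le_add]
  refine csSup_le (Set.Nonempty.image _ ⟨p, hNash.1⟩) ?_
  rintro _ ⟨z, ⟨hz0, hz1, hzs⟩, rfl⟩
  have := hC T hT (z 0 - p 0) (by linarith) (by linarith)
  rw [← sub_le_iff_le_add, ← sum_sub_distrib]
  refine le_trans (le_of_eq (sum_congr rfl fun t _ => ?_)) this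
  have hz : z 1 = 1 - z 0 := by linarith
  simp only [dot2, hz, hx1]
  linear_combination (z 0 - g.x1 t 0) * hgap t
end

section
/- Let A be a 2x2 zero-sum game that has a unique Nash equilibrium (x₁*, x₂*), and this equilibrium is fully mixed. For any fixed step size η > 0 and any initial payoff vectors, if both players update their strategies by gradient descent, then the time-averaged strategies x̄ᵢᵀ = (1/T)·Σ_{t=1}^{T} xᵢᵗ converge to the Nash equilibrium: x̄₁ᵀ → x₁* and x̄₂ᵀ → x₂* as T → ∞. -/
open Finset

/-- `f` is a subgradient selection of the coercive function `F`, constant on `[1, ∞)` and on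
`(-∞, -1]`. -/
structure IsSaturatingSubgradient (F f : ℝ → ℝ) (M δ : ℝ) : Prop where
  subgradient : ∀ x z, f x * (z - x) ≤ F z - F x
  abs_le : ∀ x, |f x| ≤ M
  right : ∀ x, 1 ≤ x → f x = f 1
  left : ∀ x, x ≤ -1 → f x = f (-1)
  right_nonneg : 0 ≤ f 1
  left_nonpos : f (-1) ≤ 0
  lower : ∀ x, δ * |x| - M ≤ F x
  upper : ∀ x, F x ≤ M * |x|

lemma IsSaturatingSubgradient.reflect {F f : ℝ → ℝ} {M δ : ℝ}
    (h : IsSaturatingSubgradient F f M δ) :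
    IsSaturatingSubgradient (fun x => F (-x)) (fun x => -f (-x)) M δ where
  subgradient x z := by have := h.subgradient (-x) (-z); linarith
  abs_le x := by simpa using h.abs_le (-x)
  right x hx := by simp only [h.left (-x) (by linarith)]
  left x hx := by simp only [h.right (-x) (by linarith), neg_neg]
  right_nonneg := by simpa using h.left_nonpos
  left_nonpos := by simpa using h.right_nonneg
  lower x := by simpa using h.lower (-x)
  upper x := by simpa using h.upper (-x)

/-- The truncation of `x` to `[-a, b]`. -/
noncomputable def truncate (a b x : ℝ) : ℝ := max (-a) (min x b)

lemma neg_le_truncate (a b x : ℝ) : -a ≤ truncate a b x := le_max_left _ _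

lemma truncate_le {a b : ℝ} (hab : -a ≤ b) (x : ℝ) : truncate a b x ≤ b :=
  max_le hab (min_le_right _ _)

lemma truncate_mono (a b : ℝ) : Monotone (truncate a b) := fun _ _ h =>
  max_le_max le_rfl (min_le_min h le_rfl)

lemma truncate_of_mem {a b x : ℝ} (ha : -a ≤ x) (hb : x ≤ b) : truncate a b x = x := by
  simp [truncate, ha, hb]

lemma truncate_of_ge {a b x : ℝ} (hab : -a ≤ b) (hb : b ≤ x) : truncate a b x = b := by
  simp [truncate, hb, hab]

lemma truncate_of_le {a b x : ℝ} (ha : x ≤ -a) : truncate a b x = -a := by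
  simp [truncate, ha]

lemma truncate_neg {a : ℝ} (ha : 0 ≤ a) (x : ℝ) : truncate a a (-x) = -truncate a a x := by
  unfold truncate
  rw [← min_neg_neg, neg_neg, ← max_neg_neg, max_min_distrib_left, max_eq_right (by linarith : -a ≤ a),
    min_comm, max_comm, min_comm]

lemma abs_truncate_le {a : ℝ} (ha : 0 ≤ a) (x : ℝ) : |truncate a a x| ≤ a :=
  abs_le.2 ⟨neg_le_truncate a a x, truncate_le (by linarith) x⟩

lemma truncate_sub_le (a b : ℝ) {x z : ℝ} (h : x ≤ z) :
    truncate a b z - truncate a b x ≤ z - x := by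
  unfold truncate
  rcases max_cases (-a) (min z b) with h1 | h1 <;> rcases max_cases (-a) (min x b) with h2 | h2 <;>
  rcases min_cases z b with h3 | h3 <;> rcases min_cases x b with h4 | h4 <;> linarith

/-- Truncation is the metric projection onto `[-a, b]`. -/
lemma truncate_variational {a b s : ℝ} (hs : -a ≤ s) (hs' : s ≤ b) (x : ℝ) :
    (s - truncate a b x) * (x - truncate a b x) ≤ 0 := by
  rcases le_total x (-a) with h | h
  · rw [truncate_of_le h]; nlinarith
  rcases le_total x b with h' | h'
  · simp [truncate_of_mem h h']
  · rw [truncate_of_ge (by linarith) h']; nlinarith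

lemma isSaturatingSubgradient_truncate {c a b δ : ℝ} (hc : 0 < c) (ha : 0 < a) (hb : 0 < b)
    (ha1 : a ≤ 1) (hb1 : b ≤ 1) (hδa : δ ≤ c * a) (hδb : δ ≤ c * b) :
    IsSaturatingSubgradient
      (fun x => c * (truncate a b x * x - truncate a b x ^ 2 / 2))
      (fun x => c * truncate a b x) c δ where
  subgradient x z := by
    have h := truncate_variational (neg_le_truncate a b x) (truncate_le (by linarith) x) z
    nlinarith [sq_nonneg (truncate a b x - truncate a b z)]
  abs_le x := by
    rw [abs_mul, abs_of_pos hc]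
    refine mul_le_of_le_one_right hc.le (abs_le.2 ⟨?_, ?_⟩)
    · linarith [neg_le_truncate a b x]
    · linarith [truncate_le (show -a ≤ b by linarith) x]
  right x hx := by
    simp only [truncate_of_ge (show -a ≤ b by linarith) (hb1.trans hx),
      truncate_of_ge (show -a ≤ b by linarith) hb1]
  left x hx := by
    simp only [truncate_of_le (show x ≤ -a by linarith),
      truncate_of_le (show (-1 : ℝ) ≤ -a by linarith)]
  right_nonneg := by
    rw [truncate_of_ge (by linarith) hb1]; positivity
  left_nonpos := by
    rw [truncate_of_le (by linarith)]; nlinarith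
  lower x := by
    rcases le_total 0 x with hx | hx
    · have h := truncate_variational (show -a ≤ b by linarith) le_rfl x
      have h1 : b * x - b ^ 2 / 2 ≤ truncate a b x * x - truncate a b x ^ 2 / 2 := by
        nlinarith [sq_nonneg (b - truncate a b x)]
      have h2 := mul_le_mul_of_nonneg_left h1 hc.le
      have h3 := mul_le_mul_of_nonneg_right hδb hx
      have h4 : c * b ^ 2 ≤ c := mul_le_of_le_one_right hc.le (by nlinarith)
      rw [abs_of_nonneg hx]
      linarith
    · have h := truncate_variational le_rfl (show -a ≤ b by linarith) x
      have h1 : -a * x - a ^ 2 / 2 ≤ truncate a b x * x - truncate a b x ^ 2 / 2 := by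
        nlinarith [sq_nonneg (-a - truncate a b x)]
      have h2 := mul_le_mul_of_nonneg_left h1 hc.le
      have h3 := mul_le_mul_of_nonneg_right hδa (neg_nonneg.2 hx)
      have h4 : c * a ^ 2 ≤ c := mul_le_of_le_one_right hc.le (by nlinarith)
      rw [abs_of_nonpos hx]
      linarith
  upper x := by
    refine mul_le_mul_of_nonneg_left ?_ hc.le
    have h : |truncate a b x| ≤ 1 := abs_le.2
      ⟨by linarith [neg_le_truncate a b x], by linarith [truncate_le (show -a ≤ b by linarith) x]⟩
    have h1 : truncate a b x * x ≤ |x| := (le_abs_self _).trans <| by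
      rw [abs_mul]; exact mul_le_of_le_one_left (abs_nonneg x) h
    nlinarith [sq_nonneg (truncate a b x)]

/-- The energy `F x + G y`, corrected by a bounded term that absorbs the energy gained when one
coordinate crosses the region where the strategies are not constant. -/
noncomputable def correctedEnergy (F G : ℝ → ℝ) (M R x y : ℝ) : ℝ :=
  F x + G y + 2 * M / R * (truncate (1 + M) (1 + M) y * truncate R R x -
    truncate (1 + M) (1 + M) x * truncate R R y)

lemma correctedEnergy_rotate (F G : ℝ → ℝ) {M R : ℝ} (hM : 0 < M) (hR : 0 < R) (x y : ℝ) :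
    correctedEnergy G (fun z => F (-z)) M R y (-x) = correctedEnergy F G M R x y := by
  simp only [correctedEnergy, truncate_neg hR.le, truncate_neg (show 0 ≤ 1 + M by linarith),
    neg_neg]
  ring

lemma abs_correctedEnergy_sub_le (F G : ℝ → ℝ) {M R : ℝ} (hM : 0 < M) (hR : 0 < R) (x y : ℝ) :
    |correctedEnergy F G M R x y - (F x + G y)| ≤ 4 * M * (1 + M) := by
  have hK : 0 ≤ 1 + M := by linarith
  have h (u v : ℝ) : |truncate (1 + M) (1 + M) u * truncate R R v| ≤ (1 + M) * R := by
    rw [abs_mul]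
    exact mul_le_mul (abs_truncate_le hK u) (abs_truncate_le hR.le v) (abs_nonneg _) hK
  have h1 : |truncate (1 + M) (1 + M) y * truncate R R x -
      truncate (1 + M) (1 + M) x * truncate R R y| ≤ 2 * ((1 + M) * R) := by
    have := abs_sub (truncate (1 + M) (1 + M) y * truncate R R x)
      (truncate (1 + M) (1 + M) x * truncate R R y)
    linarith [h y x, h x y]
  rw [correctedEnergy, add_sub_cancel_left, abs_mul, abs_of_nonneg (by positivity)]
  calc 2 * M / R * _ ≤ 2 * M / R * (2 * ((1 + M) * R)) := by gcongr
    _ = 4 * M * (1 + M) := by field_simp; ring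

lemma correctedEnergy_step_of_le {F f G g : ℝ → ℝ} {M δ R x y : ℝ}
    (hf : IsSaturatingSubgradient F f M δ) (hg : IsSaturatingSubgradient G g M δ)
    (hM : 0 < M) (hR : 0 < R) (hy : R + 2 * M + 1 ≤ y) :
    correctedEnergy F G M R (x + g y) (y - f x) ≤
      correctedEnergy F G M R x y + 2 * M ^ 2 * (1 + M) / R := by
  obtain ⟨hfx, hfx'⟩ := abs_le.1 (hf.abs_le x)
  have hgy : g y = g 1 := hg.right y (by linarith)
  have hgy' : g (y - f x) = g 1 := hg.right _ (by linarith)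
  have hg0 : 0 ≤ g y := hgy ▸ hg.right_nonneg
  have hgM : g y ≤ M := (abs_le.1 (hg.abs_le y)).2
  have hK : -(1 + M) ≤ 1 + M := by linarith
  have hRR : -R ≤ R := by linarith
  have hF : F (x + g y) - F x ≤ f (x + g y) * g y := by
    have := hf.subgradient (x + g y) x
    linarith
  have hG : G (y - f x) - G y ≤ -(g y * f x) := by
    have := hg.subgradient (y - f x) y
    rw [hgy', ← hgy] at this
    linarith
  have hcross : (f (x + g y) - f x) * g y ≤ 2 * M *
      (truncate (1 + M) (1 + M) (x + g y) - truncate (1 + M) (1 + M) x) := by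
    have hmono := truncate_mono (1 + M) (1 + M) (show x ≤ x + g y by linarith)
    rcases le_or_gt 1 x with h | h
    · rw [hf.right x h, hf.right (x + g y) (by linarith)]
      nlinarith
    rcases le_or_gt (x + g y) (-1) with h' | h'
    · rw [hf.left x (by linarith), hf.left (x + g y) h']
      nlinarith
    · rw [truncate_of_mem (x := x) (by linarith) (by linarith),
        truncate_of_mem (x := x + g y) (by linarith) (by linarith)]
      have := (abs_le.1 (hf.abs_le (x + g y))).2
      nlinarith
  have hslow : 2 * M / R * ((1 + M) * (truncate R R (x + g y) - truncate R R x)) ≤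
      2 * M ^ 2 * (1 + M) / R := by
    have h := truncate_sub_le R R (show x ≤ x + g y by linarith)
    calc 2 * M / R * ((1 + M) * (truncate R R (x + g y) - truncate R R x))
        ≤ 2 * M / R * ((1 + M) * M) := by gcongr; linarith
      _ = 2 * M ^ 2 * (1 + M) / R := by ring
  have hcancel (u : ℝ) : 2 * M / R * (u * R) = 2 * M * u := by field_simp
  simp only [correctedEnergy]
  rw [truncate_of_ge (x := y) hK (by linarith), truncate_of_ge (x := y - f x) hK (by linarith),
    truncate_of_ge (x := y) hRR (by linarith), truncate_of_ge (x := y - f x) hRR (by linarith)]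
  rw [mul_sub, mul_sub, hcancel, hcancel]
  linarith

lemma correctedEnergy_step {F f G g : ℝ → ℝ} {M δ R x y : ℝ}
    (hf : IsSaturatingSubgradient F f M δ) (hg : IsSaturatingSubgradient G g M δ)
    (hM : 0 < M) (hR : 0 < R) (hxy : R + 2 * M + 1 ≤ |x| ∨ R + 2 * M + 1 ≤ |y|) :
    correctedEnergy F G M R (x + g y) (y - f x) ≤
      correctedEnergy F G M R x y + 2 * M ^ 2 * (1 + M) / R := by
  have hrot {F f G g : ℝ → ℝ} {x y : ℝ} (hf : IsSaturatingSubgradient F f M δ)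
      (hg : IsSaturatingSubgradient G g M δ) (hx : R + 2 * M + 1 ≤ -x) :
      correctedEnergy F G M R (x + g y) (y - f x) ≤
        correctedEnergy F G M R x y + 2 * M ^ 2 * (1 + M) / R := by
    have h := correctedEnergy_step_of_le (x := y) (y := -x) hg hf.reflect hM hR hx
    rw [neg_neg, ← sub_eq_add_neg, ← neg_add', correctedEnergy_rotate F G hM hR,
      correctedEnergy_rotate F G hM hR] at h
    exact h
  have hrot2 {F f G g : ℝ → ℝ} {x y : ℝ} (hf : IsSaturatingSubgradient F f M δ)
      (hg : IsSaturatingSubgradient G g M δ) (hy : R + 2 * M + 1 ≤ -y) :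
      correctedEnergy F G M R (x + g y) (y - f x) ≤
        correctedEnergy F G M R x y + 2 * M ^ 2 * (1 + M) / R := by
    have h := hrot (x := y) (y := -x) hg hf.reflect hy
    rw [neg_neg, ← sub_eq_add_neg, ← neg_add', correctedEnergy_rotate F G hM hR,
      correctedEnergy_rotate F G hM hR] at h
    exact h
  rcases hxy with h | h <;> rcases le_abs.1 h with h | h
  · have h := hrot2 (x := y) (y := -x) hg hf.reflect (by linarith)
    rw [neg_neg, ← sub_eq_add_neg, ← neg_add', correctedEnergy_rotate F G hM hR,
      correctedEnergy_rotate F G hM hR] at h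
    exact h
  · exact hrot hf hg h
  · exact correctedEnergy_step_of_le hf hg hM hR h
  · exact hrot2 hf hg h

lemma correctedEnergy_le {F f G g : ℝ → ℝ} {M δ R : ℝ}
    (hf : IsSaturatingSubgradient F f M δ) (hg : IsSaturatingSubgradient G g M δ)
    (hM : 0 < M) (hR : 0 < R) (X Y : ℕ → ℝ) (hX : ∀ t, X (t + 1) = X t + g (Y t))
    (hY : ∀ t, Y (t + 1) = Y t - f (X t)) :
    ∃ C, ∀ t : ℕ, correctedEnergy F G M R (X t) (Y t) ≤
      C + 2 * M ^ 2 * (1 + M) / R * t := by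
  refine ⟨max (correctedEnergy F G M R (X 0) (Y 0))
    (2 * (M * (R + 3 * M + 1)) + 4 * M * (1 + M)), fun t => ?_⟩
  induction t with
  | zero => simp
  | succ t ih =>
    by_cases h : R + 2 * M + 1 ≤ |X t| ∨ R + 2 * M + 1 ≤ |Y t|
    · rw [hX, hY]
      push_cast
      linarith [correctedEnergy_step hf hg hM hR h]
    · push Not at h
      have hx : |X (t + 1)| ≤ R + 3 * M + 1 := by
        rw [hX]
        linarith [abs_add_le (X t) (g (Y t)), hg.abs_le (Y t)]
      have hy : |Y (t + 1)| ≤ R + 3 * M + 1 := by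
        rw [hY]
        linarith [abs_sub (Y t) (f (X t)), hf.abs_le (X t)]
      have hF := (hf.upper (X (t + 1))).trans (mul_le_mul_of_nonneg_left hx hM.le)
      have hG := (hg.upper (Y (t + 1))).trans (mul_le_mul_of_nonneg_left hy hM.le)
      have hE := (abs_le.1 (abs_correctedEnergy_sub_le F G hM hR (X (t + 1)) (Y (t + 1)))).2
      have hpos : 0 ≤ 2 * M ^ 2 * (1 + M) / R * ((t + 1 : ℕ) : ℝ) := by positivity
      linarith [le_max_right (correctedEnergy F G M R (X 0) (Y 0))
        (2 * (M * (R + 3 * M + 1)) + 4 * M * (1 + M))]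

/-- `X` is bounded by `ε t + O(1)` for every `ε > 0`. -/
def IsSublinear (X : ℕ → ℝ) : Prop :=
  ∀ ε > 0, ∃ C, ∀ t : ℕ, |X t| ≤ C + ε * t

lemma isSublinear_of_dynamics {F f G g : ℝ → ℝ} {M δ : ℝ}
    (hf : IsSaturatingSubgradient F f M δ) (hg : IsSaturatingSubgradient G g M δ)
    (hM : 0 < M) (hδ : 0 < δ) (X Y : ℕ → ℝ) (hX : ∀ t, X (t + 1) = X t + g (Y t))
    (hY : ∀ t, Y (t + 1) = Y t - f (X t)) : IsSublinear X ∧ IsSublinear Y := by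
  have key : ∀ ε > 0, ∃ C, ∀ t : ℕ, |X t| + |Y t| ≤ C + ε * t := by
    intro ε hε
    have hR : 0 < 2 * M ^ 2 * (1 + M) / (δ * ε) := by positivity
    obtain ⟨C, hC⟩ := correctedEnergy_le hf hg hM hR X Y hX hY
    refine ⟨(C + 4 * M * (1 + M) + 2 * M) / δ, fun t => ?_⟩
    have h := hC t
    rw [div_div_cancel₀ (by positivity)] at h
    have hE := (abs_le.1 (abs_correctedEnergy_sub_le F G hM hR (X t) (Y t))).1
    have h' : δ * (|X t| + |Y t|) ≤ C + 4 * M * (1 + M) + 2 * M + δ * ε * t := by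
      linarith [hf.lower (X t), hg.lower (Y t)]
    rw [← sub_le_iff_le_add, le_div_iff₀ hδ]
    linarith
  constructor <;> intro ε hε <;> obtain ⟨C, hC⟩ := key ε hε <;> refine ⟨C, fun t => ?_⟩
  · linarith [hC t, abs_nonneg (Y t)]
  · linarith [hC t, abs_nonneg (X t)]

lemma isSublinear_truncate {c p q : ℝ} (hc : 0 < c) (hp : 0 < p) (hp1 : p < 1) (hq : 0 < q)
    (hq1 : q < 1) (X Y : ℕ → ℝ) (hX : ∀ t, X (t + 1) = X t + c * truncate q (1 - q) (Y t))
    (hY : ∀ t, Y (t + 1) = Y t - c * truncate p (1 - p) (X t)) :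
    IsSublinear X ∧ IsSublinear Y := by
  obtain ⟨m, hm, hmp, hmp', hmq, hmq'⟩ :
      ∃ m : ℝ, 0 < m ∧ m ≤ p ∧ m ≤ 1 - p ∧ m ≤ q ∧ m ≤ 1 - q :=
    ⟨min (min p (1 - p)) (min q (1 - q)), by simp [*], by simp, by simp, by simp, by simp⟩
  exact isSublinear_of_dynamics
    (isSaturatingSubgradient_truncate (δ := c * m) hc hp (by linarith) hp1.le (by linarith)
      (by gcongr) (by gcongr))
    (isSaturatingSubgradient_truncate (δ := c * m) hc hq (by linarith) hq1.le (by linarith)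
      (by gcongr) (by gcongr)) hc (by positivity) X Y hX hY

lemma tendsto_average_of_isSublinear {X b : ℕ → ℝ} {c q : ℝ} (hc : c ≠ 0)
    (hX : ∀ t, X (t + 1) = X t + c * (b t - q)) (hs : IsSublinear X) :
    Filter.Tendsto (fun T : ℕ => (T : ℝ)⁻¹ * ∑ t ∈ Icc 1 T, b t) Filter.atTop (nhds q) := by
  have hsum (T : ℕ) : c * (∑ t ∈ Icc 1 T, b t - T * q) = X (T + 1) - X 1 := by
    induction T with
    | zero => simp
    | succ T ih =>
      rw [Finset.sum_Icc_succ_top (by omega), hX (T + 1)]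
      push_cast
      linarith
  have hlim : Filter.Tendsto (fun T : ℕ => (X (T + 1) - X 1) / T) Filter.atTop (nhds 0) := by
    rw [Metric.tendsto_atTop]
    intro ε hε
    obtain ⟨C, hC⟩ := hs (ε / 2) (by positivity)
    obtain ⟨N, hN⟩ := exists_nat_gt ((C + ε / 2 + |X 1|) / (ε / 2))
    refine ⟨max N 1, fun T hT => ?_⟩
    have hT0 : (0 : ℝ) < T := by
      have : 1 ≤ T := (le_max_right _ _).trans hT
      exact_mod_cast this
    have hNT : (N : ℝ) ≤ T := by exact_mod_cast (le_max_left _ _).trans hT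
    have h1 := (div_lt_iff₀ (by positivity)).1 (hN.trans_le hNT)
    have h2 := hC (T + 1)
    push_cast at h2
    rw [dist_zero_right, Real.norm_eq_abs, abs_div, abs_of_pos hT0, div_lt_iff₀ hT0]
    linarith [abs_sub (X (T + 1)) (X 1)]
  have h := (hlim.const_mul c⁻¹).const_add q
  rw [mul_zero, add_zero] at h
  refine h.congr' ?_
  filter_upwards [Filter.eventually_gt_atTop 0] with T hT
  have hT0 : (T : ℝ) ≠ 0 := by exact_mod_cast hT.ne'
  rw [← hsum]
  field_simp
  ring

/-- A gradient descent strategy is the truncation of the payoff difference, here centred at `p`. -/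
lemma IsGDArgmax.apply_zero_sub {η : ℝ} (hη : 0 < η) {y x : Fin 2 → ℝ} (h : IsGDArgmax η y x)
    {p : ℝ} (hp : 0 < p) (hp1 : p < 1) :
    x 0 - p = truncate p (1 - p) (1 / 2 + η / 2 * (y 0 - y 1) - p) := by
  obtain ⟨⟨h0, h1, hsum⟩, hmax⟩ := h
  set U := 1 / 2 + η / 2 * (y 0 - y 1) with hU
  set k := truncate p (1 - p) (U - p) with hk
  have hk0 : -p ≤ k := neg_le_truncate _ _ _
  have hk1 : k ≤ 1 - p := truncate_le (by linarith) _
  have hvar := truncate_variational (a := p) (b := 1 - p) (s := x 0 - p) (by linarith)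
    (by linarith) (U - p)
  rw [← hk] at hvar
  have hcmp := hmax ![k + p, 1 - (k + p)] ⟨by simp; linarith, by simp; linarith, by simp⟩
  have hx1 : x 1 = 1 - x 0 := by linarith
  have hobj (s : ℝ) (z : Fin 2 → ℝ) (hz : z 0 = s) (hz1 : z 1 = 1 - s) :
      η * gdObj η y z = 2 * U * s - s ^ 2 + η * y 1 - 1 / 2 := by
    simp only [gdObj, dot2, hz, hz1, hU]
    field_simp
    ring
  have hcmp' := mul_le_mul_of_nonneg_left hcmp hη.le
  rw [hobj (k + p) _ (by simp) (by simp), hobj (x 0) x rfl hx1] at hcmp'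
  have hsq : (x 0 - p - k) ^ 2 ≤ 0 := by nlinarith
  have := pow_eq_zero_iff (two_ne_zero) |>.1 (le_antisymm hsq (sq_nonneg _))
  linarith

lemma mem_simplex2_single : (![1, 0] : Fin 2 → ℝ) ∈ simplex2 ∧ ![0, 1] ∈ simplex2 := by
  simp [simplex2]

/-- A fully mixed best response makes its player indifferent. -/
lemma eq_of_fullyMixed_of_maximizes {p w : Fin 2 → ℝ} (hp : p ∈ simplex2) (hm : FullyMixed p)
    (h : ∀ x ∈ simplex2, dot2 x w ≤ dot2 p w) : w 0 = w 1 := by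
  have h0 := h _ mem_simplex2_single.1
  have h1 := h _ mem_simplex2_single.2
  obtain ⟨-, -, hs⟩ := hp
  obtain ⟨hm0, hm1⟩ := hm
  simp only [dot2, Matrix.cons_val_zero, Matrix.cons_val_one] at h0 h1
  have hp1 : p 1 = 1 - p 0 := by linarith
  rw [hp1] at h0 h1 hm1
  apply le_antisymm <;> nlinarith

lemma dot2_mulVec (A : Matrix (Fin 2) (Fin 2) ℝ) (x y : Fin 2 → ℝ) :
    dot2 x (A.mulVec y) = dot2 y (A.transpose.mulVec x) := by
  simp only [dot2, Matrix.mulVec, dotProduct, Fin.sum_univ_two, Matrix.transpose_apply]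
  ring

lemma IsNash.indifferent {A : Matrix (Fin 2) (Fin 2) ℝ} {p q : Fin 2 → ℝ} (h : IsNash A p q)
    (hmp : FullyMixed p) (hmq : FullyMixed q) :
    A.mulVec q 0 = A.mulVec q 1 ∧ A.transpose.mulVec p 0 = A.transpose.mulVec p 1 := by
  obtain ⟨hp, hq, h1, h2⟩ := h
  refine ⟨eq_of_fullyMixed_of_maximizes hp hmp h1, ?_⟩
  have := eq_of_fullyMixed_of_maximizes (w := -A.transpose.mulVec p) hq hmq fun y hy => by
    have := h2 y hy
    rw [dot2_mulVec, dot2_mulVec A p y] at this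
    simp only [dot2, Pi.neg_apply] at this ⊢
    linarith
  exact neg_injective this

/-- The mixed difference of the payoffs, which governs the dynamics of the payoff differences. -/
def mixedDifference (A : Matrix (Fin 2) (Fin 2) ℝ) : ℝ := A 0 0 - A 0 1 - A 1 0 + A 1 1

lemma mulVec_zero_sub_one {A : Matrix (Fin 2) (Fin 2) ℝ} {q x : Fin 2 → ℝ} (hq : q ∈ simplex2)
    (hx : x ∈ simplex2) (h : A.mulVec q 0 = A.mulVec q 1) :
    A.mulVec x 0 - A.mulVec x 1 = mixedDifference A * (x 0 - q 0) := by
  have hq1 : q 1 = 1 - q 0 := by linarith [hq.2.2]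
  have hx1 : x 1 = 1 - x 0 := by linarith [hx.2.2]
  simp only [Matrix.mulVec, dotProduct, Fin.sum_univ_two, mixedDifference, hq1, hx1] at h ⊢
  linarith

lemma mixedDifference_transpose (A : Matrix (Fin 2) (Fin 2) ℝ) :
    mixedDifference A.transpose = mixedDifference A := by
  simp only [mixedDifference, Matrix.transpose_apply]
  ring

lemma mixedDifference_ne_zero {A : Matrix (Fin 2) (Fin 2) ℝ} {p q : Fin 2 → ℝ}
    (h : IsNash A p q) (hmp : FullyMixed p) (hmq : FullyMixed q)
    (hUnique : ∀ p' q', IsNash A p' q' → p' = p ∧ q' = q) : mixedDifference A ≠ 0 := by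
  intro hD
  obtain ⟨h1, h2⟩ := h.indifferent hmp hmq
  have hrow (x : Fin 2 → ℝ) (hx : x ∈ simplex2) : A.mulVec x 0 = A.mulVec x 1 := by
    have := mulVec_zero_sub_one h.2.1 hx h1
    rw [hD, zero_mul] at this
    linarith
  have hcol (x : Fin 2 → ℝ) (hx : x ∈ simplex2) :
      A.transpose.mulVec x 0 = A.transpose.mulVec x 1 := by
    have := mulVec_zero_sub_one h.1 hx h2
    rw [mixedDifference_transpose, hD, zero_mul] at this
    linarith
  have hdot {x z w : Fin 2 → ℝ} (hx : x ∈ simplex2) (hz : z ∈ simplex2) (hw : w 0 = w 1) :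
      dot2 x w = dot2 z w := by
    simp only [dot2, hw, ← add_mul, hx.2.2, hz.2.2]
  have hN : IsNash A ![1, 0] q := by
    refine ⟨mem_simplex2_single.1, h.2.1, fun x hx => ?_, fun y hy => ?_⟩
    · exact (hdot hx mem_simplex2_single.1 h1).le
    · rw [dot2_mulVec, dot2_mulVec A _ y]
      exact (hdot h.2.1 hy (hcol _ mem_simplex2_single.1)).le
  have := congrFun (hUnique _ _ hN).1 1
  simp only [Matrix.cons_val_one] at this
  exact hmp.2.ne this

lemma tendsto_average_simplex2 {x : ℕ → Fin 2 → ℝ} {p : Fin 2 → ℝ} (hx : ∀ t, x t ∈ simplex2)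
    (hp : p ∈ simplex2)
    (h : Filter.Tendsto (fun T : ℕ => (T : ℝ)⁻¹ * ∑ t ∈ Icc 1 T, x t 0) Filter.atTop
      (nhds (p 0))) :
    Filter.Tendsto (fun T : ℕ => (T : ℝ)⁻¹ • ∑ t ∈ Icc 1 T, x t) Filter.atTop (nhds p) := by
  rw [tendsto_pi_nhds, Fin.forall_fin_two]
  constructor
  · simpa using h
  · have hp1 : p 1 = 1 - p 0 := by linarith [hp.2.2]
    rw [hp1]
    refine (h.const_sub 1).congr' ?_
    filter_upwards [Filter.eventually_gt_atTop 0] with T hT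
    have hT0 : (T : ℝ) ≠ 0 := by exact_mod_cast hT.ne'
    have hx1 (t : ℕ) : x t 1 = 1 - x t 0 := by linarith [(hx t).2.2]
    simp only [Pi.smul_apply, Finset.sum_apply, smul_eq_mul, hx1, Finset.sum_sub_distrib]
    simp [mul_sub, hT0]

/-- the time-averaged strategies of gradient descent in a 2x2 zero-sum game
with a unique fully mixed Nash equilibrium converge to the Nash equilibrium. -/
theorem time_average_converges (A : Matrix (Fin 2) (Fin 2) ℝ) (p q : Fin 2 → ℝ)
    (hNash : IsNash A p q) (hmp : FullyMixed p) (hmq : FullyMixed q)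
    (hUnique : ∀ p' q', IsNash A p' q' → p' = p ∧ q' = q)
    (η : ℝ) (hη : 0 < η) (y10 y20 : Fin 2 → ℝ) (g : GD2 A η y10 y20) :
    Filter.Tendsto (fun T : ℕ => (T : ℝ)⁻¹ • ∑ t ∈ Finset.Icc 1 T, g.x1 t)
      Filter.atTop (nhds p) ∧
    Filter.Tendsto (fun T : ℕ => (T : ℝ)⁻¹ • ∑ t ∈ Finset.Icc 1 T, g.x2 t)
      Filter.atTop (nhds q) := by
  have hD := mixedDifference_ne_zero hNash hmp hmq hUnique
  obtain ⟨hq, hp⟩ := hNash.indifferent hmp hmq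
  have hpS := hNash.1
  have hqS := hNash.2.1
  have hp1 : p 0 < 1 := by linarith [hmp.2, hpS.2.2]
  have hq1 : q 0 < 1 := by linarith [hmq.2, hqS.2.2]
  set c := η / 2 * mixedDifference A with hc
  have hc0 : c ≠ 0 := mul_ne_zero (by positivity) hD
  set X : ℕ → ℝ := fun t => 1 / 2 + η / 2 * (g.y1 t 0 - g.y1 t 1) - p 0 with hXdef
  set Y : ℕ → ℝ := fun t => 1 / 2 + η / 2 * (g.y2 t 0 - g.y2 t 1) - q 0 with hYdef
  have hX (t : ℕ) : X (t + 1) = X t + c * (g.x2 t 0 - q 0) := by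
    have h := mulVec_zero_sub_one hqS (g.x2_argmax t).1 hq
    simp only [hXdef, hc, g.y1_succ, Pi.add_apply]
    linear_combination η / 2 * h
  have hY (t : ℕ) : Y (t + 1) = Y t + -c * (g.x1 t 0 - p 0) := by
    have h := mulVec_zero_sub_one hpS (g.x1_argmax t).1 hp
    rw [mixedDifference_transpose] at h
    simp only [hYdef, hc, g.y2_succ, Pi.sub_apply]
    linear_combination -η / 2 * h
  have hx1 (t : ℕ) : g.x1 t 0 - p 0 = truncate (p 0) (1 - p 0) (X t) :=
    (g.x1_argmax t).apply_zero_sub hη hmp.1 hp1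
  have hx2 (t : ℕ) : g.x2 t 0 - q 0 = truncate (q 0) (1 - q 0) (Y t) :=
    (g.x2_argmax t).apply_zero_sub hη hmq.1 hq1
  have hs : IsSublinear X ∧ IsSublinear Y := by
    rcases hc0.lt_or_gt with h | h
    · exact (isSublinear_truncate (neg_pos.2 h) hmq.1 hq1 hmp.1 hp1 Y X
        (fun t => by rw [hY, hx1]) (fun t => by rw [hX, hx2]; ring)).symm
    · exact isSublinear_truncate h hmp.1 hp1 hmq.1 hq1 X Y
        (fun t => by rw [hX, hx2]) (fun t => by rw [hY, hx1]; ring)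
  exact ⟨tendsto_average_simplex2 (fun t => (g.x1_argmax t).1) hpS
      (tendsto_average_of_isSublinear (neg_ne_zero.2 hc0) hY hs.2),
    tendsto_average_simplex2 (fun t => (g.x2_argmax t).1) hqS
      (tendsto_average_of_isSublinear hc0 hX hs.1)⟩
end

section
/- Let n ≥ 1, y ∈ ℝⁿ and η > 0, and let x* be the unique maximizer over Δₙ of the function x ↦ y·x − ‖x‖₂²/(2η). Let S = {j ∈ [n] : x*_j > 0} be the support of x*. Then S is nonempty and for every j ∈ S, x*_j = η·(y_j − (Σ_{k∈S} y_k)/|S|) + 1/|S|. -/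
open Finset

/-- The probability simplex in `ℝⁿ`. -/
def simplexN (n : ℕ) : Set (Fin n → ℝ) :=
  {x | (∀ j, 0 ≤ x j) ∧ ∑ j, x j = 1}

/-- Dot product on `ℝⁿ`. -/
noncomputable def dotN {n : ℕ} (x y : Fin n → ℝ) : ℝ := ∑ j, x j * y j

/-- The objective `y·x - ‖x‖₂²/(2η)`. -/
noncomputable def gdObjN {n : ℕ} (η : ℝ) (y x : Fin n → ℝ) : ℝ :=
  dotN y x - (∑ j, x j ^ 2) / (2 * η)

/-- `x` is a maximizer over the simplex of `z ↦ y·z - ‖z‖₂²/(2η)`. -/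
def IsGDArgmaxN {n : ℕ} (η : ℝ) (y x : Fin n → ℝ) : Prop :=
  x ∈ simplexN n ∧ ∀ z ∈ simplexN n, gdObjN η y z ≤ gdObjN η y x

/-- The vector obtained from `x` by moving mass `t` from coordinate `i` to coordinate `j`. -/
def moveMass {n : ℕ} (x : Fin n → ℝ) (i j : Fin n) (t : ℝ) : Fin n → ℝ :=
  fun k => x k + t * ((if k = j then 1 else 0) - (if k = i then 1 else 0))

theorem moveMass_mem_simplexN {n : ℕ} {x : Fin n → ℝ} (hx : x ∈ simplexN n) (i j : Fin n)
    {t : ℝ} (ht : 0 ≤ t) (hti : t ≤ x i) : moveMass x i j t ∈ simplexN n := by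
  refine ⟨fun k => ?_, ?_⟩
  · have hk := hx.1 k
    unfold moveMass
    by_cases hki : k = i
    · subst hki
      split_ifs <;> simp <;> linarith
    · simp only [if_neg hki]
      split_ifs <;> simp <;> linarith
  · simp [moveMass, Finset.sum_add_distrib, ← Finset.mul_sum, hx.2]

theorem gdObjN_moveMass {n : ℕ} (η : ℝ) (y x : Fin n → ℝ) {i j : Fin n} (hij : i ≠ j) (t : ℝ) :
    gdObjN η y (moveMass x i j t) =
      gdObjN η y x + (t * (y j - y i) - (2 * t * (x j - x i) + 2 * t ^ 2) / (2 * η)) := by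
  have hdot : dotN y (moveMass x i j t) = dotN y x + t * (y j - y i) := by
    simp only [dotN, moveMass, mul_add, Finset.sum_add_distrib]
    congr 1
    simp only [mul_left_comm _ t, ← Finset.mul_sum, mul_sub, Finset.sum_sub_distrib]
    simp
  have hsq : ∑ k, moveMass x i j t k ^ 2 =
      ∑ k, x k ^ 2 + (2 * t * (x j - x i) + 2 * t ^ 2) := by
    have h : ∀ k, moveMass x i j t k ^ 2 = x k ^ 2 +
        ((if k = j then 2 * t * x k + t ^ 2 else 0) +
          (if k = i then t ^ 2 - 2 * t * x k else 0)) := by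
      intro k
      unfold moveMass
      by_cases hki : k = i
      · subst hki
        simp only [if_neg hij, if_true]
        ring
      · simp only [if_neg hki]
        split_ifs <;> ring
    simp only [h, Finset.sum_add_distrib, Finset.sum_ite_eq', Finset.mem_univ, if_true]
    ring
  rw [gdObjN, gdObjN, hdot, hsq]
  ring

/-- First-order optimality: `η * y j - x j` is maximal at the support coordinates of a
maximizer. -/
theorem IsGDArgmaxN.mul_sub_le {n : ℕ} {η : ℝ} (hη : 0 < η) {y x : Fin n → ℝ}
    (hx : IsGDArgmaxN η y x) {i : Fin n} (hi : 0 < x i) (j : Fin n) :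
    η * y j - x j ≤ η * y i - x i := by
  rcases eq_or_ne i j with rfl | hij
  · exact le_rfl
  by_contra! hlt
  set t := min (x i) ((η * y j - x j - (η * y i - x i)) / 2)
  have ht : 0 < t := lt_min hi (by linarith)
  have htg : t ≤ (η * y j - x j - (η * y i - x i)) / 2 := min_le_right _ _
  have hmax := hx.2 _ (moveMass_mem_simplexN hx.1 i j ht.le (min_le_left _ _))
  rw [gdObjN_moveMass η y x hij] at hmax
  have hgain : t * (y j - y i) ≤ (2 * t * (x j - x i) + 2 * t ^ 2) / (2 * η) := by linarith
  rw [le_div_iff₀ (by positivity)] at hgain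
  have : 0 < t * (η * y j - x j - (η * y i - x i) - t) := mul_pos ht (by linarith)
  linarith

/-- the maximizer of the gradient descent step has the given closed form
on its support. -/
theorem gd_argmax_support_form (n : ℕ) (hn : 1 ≤ n) (η : ℝ) (hη : 0 < η)
    (y : Fin n → ℝ) (x : Fin n → ℝ) (hx : IsGDArgmaxN η y x)
    (S : Finset (Fin n)) (hS : S = Finset.univ.filter fun j => 0 < x j) :
    S.Nonempty ∧ ∀ j ∈ S,
      x j = η * (y j - (∑ k ∈ S, y k) / (S.card : ℝ)) + 1 / (S.card : ℝ) := by
  subst hS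
  set S := Finset.univ.filter fun j => 0 < x j with hS
  have hsum : ∑ k ∈ S, x k = 1 := by
    rw [← hx.1.2]
    refine Finset.sum_subset (Finset.subset_univ _) fun k _ hk => ?_
    exact le_antisymm (by simpa [hS] using hk) (hx.1.1 k)
  have hne : S.Nonempty := by
    rw [Finset.nonempty_iff_ne_empty]
    intro h
    simp [h] at hsum
  refine ⟨hne, fun j hj => ?_⟩
  have hcard : (0 : ℝ) < S.card := by exact_mod_cast hne.card_pos
  have hconst : ∀ k ∈ S, x k = η * y k + (x j - η * y j) := by
    intro k hk
    have h₁ := hx.mul_sub_le hη (Finset.mem_filter.mp hk).2 j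
    have h₂ := hx.mul_sub_le hη (Finset.mem_filter.mp hj).2 k
    linarith
  rw [Finset.sum_congr rfl hconst, Finset.sum_add_distrib, ← Finset.mul_sum,
    Finset.sum_const, nsmul_eq_mul] at hsum
  field_simp
  linarith
end

section
/- Let A = [[a, b], [c, d]] ∈ ℝ^{2×2} be singular, i.e., ad = bc, and run gradient descent with any step size η > 0 and initial payoff vectors y₁⁰, y₂⁰ ∈ ℝ². If (d − c)·y₁₁⁰ + (a − b)·y₁₂⁰ = 0, then (d − c)·y₁₁ᵗ + (a − b)·y₁₂ᵗ = 0 for all t ≥ 0. Similarly, if (a − c)·y₂₂⁰ − (b − d)·y₂₁⁰ = 0, then (a − c)·y₂₂ᵗ − (b − d)·y₂₁ᵗ = 0 for all t ≥ 0. -/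
open Finset

/-- for a singular payoff matrix, the displayed linear functionals of the
payoff vectors are invariant under the gradient descent dynamics. -/
theorem dual_space_invariant (a b c d : ℝ) (A : Matrix (Fin 2) (Fin 2) ℝ)
    (hA : A = !![a, b; c, d]) (had : a * d = b * c)
    (η : ℝ) (hη : 0 < η) (y10 y20 : Fin 2 → ℝ) (g : GD2 A η y10 y20) :
    ((d - c) * y10 0 + (a - b) * y10 1 = 0 →
      ∀ t : ℕ, (d - c) * g.y1 t 0 + (a - b) * g.y1 t 1 = 0) ∧
    ((a - c) * y20 1 - (b - d) * y20 0 = 0 →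
      ∀ t : ℕ, (a - c) * g.y2 t 1 - (b - d) * g.y2 t 0 = 0) := by
  subst hA
  constructor
  · intro h t
    induction t with
    | zero => rwa [g.y1_zero]
    | succ t ih =>
      simp only [g.y1_succ, Pi.add_apply, Matrix.mulVec, dotProduct, Fin.sum_univ_two,
        Matrix.of_apply, Matrix.cons_val_zero, Matrix.cons_val_one]
      linear_combination ih + (g.x2 t 0 + g.x2 t 1) * had
  · intro h t
    induction t with
    | zero => rwa [g.y2_zero]
    | succ t ih =>
      simp only [g.y2_succ, Pi.sub_apply, Matrix.mulVec, dotProduct, Fin.sum_univ_two,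
        Matrix.transpose_apply, Matrix.of_apply, Matrix.cons_val_zero, Matrix.cons_val_one]
      linear_combination ih - (g.x1 t 0 + g.x1 t 1) * had
end

section
/- Let A = [[a, b], [c, d]] ∈ ℝ^{2×2} satisfy ad = bc, a > max{0, b, c}, and d > max{0, b, c}, and run gradient descent with any step size η > 0. Let x₁₁^{NE} = (d − c)/(a + d − b − c) and x₂₁^{NE} = (d − b)/(a + d − b − c) denote the first coordinates of the players' fully mixed Nash equilibrium strategies. Then the strategies rotate clockwise around the equilibrium: for every t ≥ 0, (i) if x₂₁ᵗ ≥ x₂₁^{NE} then x₁₁ᵗ⁺¹ ≥ x₁₁ᵗ, and (ii) if x₁₁ᵗ ≥ x₁₁^{NE} then x₂₁ᵗ⁺¹ ≤ x₂₁ᵗ. -/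
open Finset

/-- The first coordinate of the maximizer is monotone in the payoff difference `y 0 - y 1`. -/
theorem IsGDArgmax.mono {η : ℝ} (hη : 0 < η) {y y' x x' : Fin 2 → ℝ}
    (h : IsGDArgmax η y x) (h' : IsGDArgmax η y' x') (hy : y 0 - y 1 ≤ y' 0 - y' 1) :
    x 0 ≤ x' 0 := by
  obtain ⟨⟨h0, h1, hs⟩, hmax⟩ := h
  obtain ⟨⟨h0', h1', hs'⟩, hmax'⟩ := h'
  by_contra! hlt
  have hm : ![(x 0 + x' 0) / 2, (x 1 + x' 1) / 2] ∈ simplex2 := by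
    refine ⟨?_, ?_, ?_⟩ <;>
      simp only [Matrix.cons_val_zero, Matrix.cons_val_one] <;> linarith
  have e := hmax _ hm
  have e' := hmax' _ hm
  have hk : 0 < (2 * η)⁻¹ := by positivity
  simp only [gdObj, dot2, div_eq_mul_inv _ (2 * η), Matrix.cons_val_zero,
    Matrix.cons_val_one] at e e'
  generalize (2 * η)⁻¹ = k at *
  rw [show x 1 = 1 - x 0 by linarith, show x' 1 = 1 - x' 0 by linarith] at e e'
  have hsq : 0 < k * (x 0 - x' 0) ^ 2 := mul_pos hk (pow_pos (sub_pos.2 hlt) 2)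
  have hmul := mul_nonneg (sub_nonneg.2 hy) (sub_pos.2 hlt).le
  nlinarith

/-- the strategies rotate clockwise around the fully mixed Nash
equilibrium. -/
theorem clockwise_rotation (a b c d : ℝ) (A : Matrix (Fin 2) (Fin 2) ℝ)
    (hA : A = !![a, b; c, d]) (had : a * d = b * c)
    (ha : a > max 0 (max b c)) (hd : d > max 0 (max b c))
    (η : ℝ) (hη : 0 < η) (y10 y20 : Fin 2 → ℝ) (g : GD2 A η y10 y20) :
    ∀ t : ℕ,
      (g.x2 t 0 ≥ (d - b) / (a + d - b - c) → g.x1 (t + 1) 0 ≥ g.x1 t 0) ∧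
      (g.x1 t 0 ≥ (d - c) / (a + d - b - c) → g.x2 (t + 1) 0 ≤ g.x2 t 0) := by
  intro t
  have hpos : 0 < a + d - b - c := by
    have hb := (le_max_left b c).trans (le_max_right 0 (max b c))
    have hc := (le_max_right b c).trans (le_max_right 0 (max b c))
    linarith
  obtain ⟨-, -, hs1⟩ := (g.x1_argmax t).1
  obtain ⟨-, -, hs2⟩ := (g.x2_argmax t).1
  refine ⟨fun h => (g.x1_argmax t).mono hη (g.x1_argmax (t + 1)) ?_,
    fun h => (g.x2_argmax (t + 1)).mono hη (g.x2_argmax t) ?_⟩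
  · rw [ge_iff_le, div_le_iff₀ hpos] at h
    simp only [g.y1_succ, hA, Pi.add_apply, Matrix.mulVec, dotProduct, Fin.sum_univ_two,
      Matrix.of_apply, Matrix.cons_val_zero, Matrix.cons_val_one]
    rw [show g.x2 t 1 = 1 - g.x2 t 0 by linarith]
    linarith
  · rw [ge_iff_le, div_le_iff₀ hpos] at h
    simp only [g.y2_succ, hA, Pi.sub_apply, Matrix.mulVec, dotProduct, Fin.sum_univ_two,
      Matrix.transpose_apply, Matrix.of_apply, Matrix.cons_val_zero, Matrix.cons_val_one]
    rw [show g.x1 t 1 = 1 - g.x1 t 0 by linarith]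
    linarith
end

section
/- Let A = [[a, b], [c, d]] ∈ ℝ^{2×2} satisfy ad = bc, a > max{0, b, c}, and d > max{0, b, c}, and run gradient descent with step size η > 0 from initial payoff vectors satisfying (a − c)·y₂₂⁰ = (b − d)·y₂₁⁰. Set λ = (η/2)·(1 − (b − d)/(a − c)), z₂ᵗ = λ·y₂₁ᵗ + 1/2, and δ = a·λ (note λ > 0 and δ > 0). Suppose s ≤ s′ are iterations such that for every t ∈ {s, …, s′}, x₁ᵗ = (1, 0) and z₂ᵗ > 0. Then the number of iterations t ∈ {s, …, s′ − 1} with x₂ᵗ ≠ x₂ᵗ⁺¹ is at most ⌈1/δ⌉. -/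
open Finset

open scoped Classical

/-- If the optimum of the objective over the line `x 0 + x 1 = 1` has first coordinate at
least `1`, then the
gradient descent response is the pure strategy `(1, 0)`. -/
theorem IsGDArgmax.eq_pure {η : ℝ} (hη : 0 < η) {y x : Fin 2 → ℝ} (h : IsGDArgmax η y x)
    (hy : 1 ≤ η / 2 * (y 0 - y 1) + 1 / 2) : x = ![1, 0] := by
  obtain ⟨⟨h0, h1, hsum⟩, hmax⟩ := h
  have hm := hmax ![1, 0] (by simp [simplex2])
  have hx1 : x 1 = 1 - x 0 := by linarith
  simp only [gdObj, dot2, Matrix.cons_val_zero, Matrix.cons_val_one, hx1] at hm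
  have hm' := mul_le_mul_of_nonneg_left hm hη.le
  have e1 : η * (y 0 * 1 + y 1 * 0 - (1 ^ 2 + 0 ^ 2) / (2 * η)) = η * y 0 - 1 / 2 := by
    field_simp
    ring
  have e2 : η * (y 0 * x 0 + y 1 * (1 - x 0) - (x 0 ^ 2 + (1 - x 0) ^ 2) / (2 * η)) =
      η * (y 0 * x 0 + y 1 * (1 - x 0)) - (x 0 ^ 2 + (1 - x 0) ^ 2) / 2 := by
    field_simp
  rw [e1, e2] at hm'
  have hx0 : x 0 = 1 := by
    have hle : x 0 ≤ 1 := by linarith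
    nlinarith [mul_nonneg (sub_nonneg.2 hle) (sub_nonneg.2 hy), sq_nonneg (1 - x 0)]
  ext i
  fin_cases i
  · simpa using hx0
  · simp [hx1, hx0]

/-- For a singular payoff matrix, the payoff vectors of player 2 stay on a fixed line through the
origin. -/
theorem GD2.payoff_line {a b c d η : ℝ} {y10 y20 : Fin 2 → ℝ}
    (g : GD2 !![a, b; c, d] η y10 y20) (had : a * d = b * c)
    (hinit : (a - c) * y20 1 = (b - d) * y20 0) (t : ℕ) :
    (a - c) * g.y2 t 1 = (b - d) * g.y2 t 0 := by
  induction t with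
  | zero => rw [g.y2_zero, hinit]
  | succ t ih =>
    rw [g.y2_succ]
    simp only [Pi.sub_apply, Matrix.mulVec, dotProduct, Fin.sum_univ_two, Matrix.transpose_apply,
      Matrix.of_apply, Matrix.cons_val_zero, Matrix.cons_val_one]
    linear_combination ih - (g.x1 t 0 + g.x1 t 1) * had

/-- while player 1 plays the pure strategy `(1,0)` and `z₂ᵗ > 0`,
player 2's strategy changes at most `⌈1/δ⌉` times. -/
theorem few_strategy_changes (a b c d : ℝ) (A : Matrix (Fin 2) (Fin 2) ℝ)
    (hA : A = !![a, b; c, d]) (had : a * d = b * c)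
    (ha : a > max 0 (max b c)) (hd : d > max 0 (max b c))
    (η : ℝ) (hη : 0 < η) (y10 y20 : Fin 2 → ℝ)
    (hinit : (a - c) * y20 1 = (b - d) * y20 0)
    (g : GD2 A η y10 y20)
    (lam : ℝ) (hlam : lam = η / 2 * (1 - (b - d) / (a - c)))
    (z2 : ℕ → ℝ) (hz2 : ∀ t, z2 t = lam * g.y2 t 0 + 1 / 2)
    (δ : ℝ) (hδ : δ = a * lam)
    (s s' : ℕ) (hss : s ≤ s')
    (hseg : ∀ t, s ≤ t → t ≤ s' → g.x1 t = ![1, 0] ∧ 0 < z2 t) :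
    ((Finset.Ico s s').filter fun t => g.x2 t ≠ g.x2 (t + 1)).card ≤ ⌈1 / δ⌉₊ := by
  subst hA
  have hac : 0 < a - c := sub_pos.2 ((le_max_right _ _).trans (le_max_right _ _) |>.trans_lt ha)
  have hdb : b < d := ((le_max_left _ _).trans (le_max_right _ _)).trans_lt hd
  have ha0 : 0 < a := (le_max_left _ _).trans_lt ha
  have hlam0 : 0 < lam := by
    have : (b - d) / (a - c) < 0 := div_neg_of_neg_of_pos (by linarith) hac
    rw [hlam]
    exact mul_pos (by linarith) (by linarith)
  have hδ0 : 0 < δ := hδ ▸ mul_pos ha0 hlam0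
  have hstep : ∀ t, s ≤ t → t ≤ s' → z2 (t + 1) = z2 t - δ := by
    intro t h1 h2
    rw [hz2, hz2, g.y2_succ, (hseg t h1 h2).1, hδ]
    simp
    ring
  have hpure : ∀ t, 1 ≤ z2 t → g.x2 t = ![1, 0] := by
    intro t ht
    refine (g.x2_argmax t).eq_pure hη ?_
    have hy1 : g.y2 t 1 = (b - d) / (a - c) * g.y2 t 0 := by
      rw [div_mul_eq_mul_div, eq_div_iff hac.ne', mul_comm]
      exact g.payoff_line had hinit t
    rw [hz2, hlam] at ht
    rw [hy1]
    linarith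
  have hchange : ∀ t, s ≤ t → t < s' → g.x2 t ≠ g.x2 (t + 1) → z2 (t + 1) < 1 := by
    intro t h1 h2 hne
    by_contra! hge
    refine hne ?_
    rw [hpure (t + 1) hge, hpure t (by linarith [hstep t h1 h2.le])]
  set F := (Finset.Ico s s').filter fun t => g.x2 t ≠ g.x2 (t + 1) with hF
  rcases F.eq_empty_or_nonempty with hE | hne
  · simp [hE]
  set m := F.min' hne
  have hm := F.min'_mem hne
  obtain ⟨hmI, hmne⟩ := Finset.mem_filter.1 hm
  obtain ⟨hsm, hms⟩ := Finset.mem_Ico.1 hmI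
  have hlt := hchange m hsm hms hmne
  have hcard : F.card ≤ s' - m := by
    rw [← Nat.card_Ico]
    refine Finset.card_le_card fun t ht => Finset.mem_Ico.2 ⟨F.min'_le t ht, ?_⟩
    exact (Finset.mem_Ico.1 (Finset.mem_filter.1 ht).1).2
  have hlin : ∀ k : ℕ, m + 1 + k ≤ s' → z2 (m + 1 + k) = z2 (m + 1) - k * δ := by
    intro k
    induction k with
    | zero => simp
    | succ k ih =>
      intro hk
      rw [← add_assoc, hstep (m + 1 + k) (by omega) (by omega), ih (by omega)]
      push_cast
      ring
  obtain ⟨k, hk⟩ := Nat.exists_eq_add_of_le (Nat.succ_le_of_lt hms)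
  have hpos := (hseg s' hss le_rfl).2
  rw [show s' = m + 1 + k from hk, hlin k hk.ge] at hpos
  have hkδ : (k : ℝ) < 1 / δ := by
    rw [lt_div_iff₀ hδ0]
    linarith
  have hkc : k < ⌈1 / δ⌉₊ := Nat.lt_ceil.2 hkδ
  omega
end

section
/- Let A = [[a, b], [c, d]] ∈ ℝ^{2×2} and run gradient descent with any step size η > 0 and any initial payoff vectors. Suppose that at iterations t and t + 1 player 1 plays the pure strategy (1, 0), i.e., x₁ᵗ = x₁ᵗ⁺¹ = (1, 0), while player 2's strategies x₂ᵗ and x₂ᵗ⁺¹ are both fully mixed (all coordinates strictly positive). Then the energy increases by exactly Eᵗ⁺¹ − Eᵗ = (η/4)·(a − b)². -/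
open Finset

/-- Convex conjugate of the regularizer: `h*(y) = max_{x ∈ Δ} (y·x − ‖x‖₂²/(2η))`. -/
noncomputable def hstar (η : ℝ) (y : Fin 2 → ℝ) : ℝ :=
  sSup (gdObj η y '' simplex2)

/-- A maximizer attains the conjugate. -/
theorem hstar_eq_of_isGDArgmax {η : ℝ} {y x : Fin 2 → ℝ} (h : IsGDArgmax η y x) :
    hstar η y = gdObj η y x :=
  IsGreatest.csSup_eq ⟨⟨x, h.1, rfl⟩, by rintro _ ⟨z, hz, rfl⟩; exact h.2 z hz⟩

/-- Moving mass `s` between the two strategies changes the objective by a quadratic in `s`. -/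
theorem IsGDArgmax.perturb_le {η : ℝ} (hη : 0 < η) {y x : Fin 2 → ℝ} (h : IsGDArgmax η y x)
    {s : ℝ} (hs0 : -x 0 ≤ s) (hs1 : s ≤ x 1) :
    s * (η * (y 0 - y 1) - (x 0 - x 1)) ≤ s ^ 2 := by
  have hz := h.2 ![x 0 + s, x 1 - s] ⟨by simp; linarith, by simp; linarith, by
    simpa using h.1.2.2⟩
  simp only [gdObj, dot2, Matrix.cons_val_zero, Matrix.cons_val_one] at hz
  have key : s ^ 2 - s * (η * (y 0 - y 1) - (x 0 - x 1)) =
      η * ((y 0 * x 0 + y 1 * x 1 - (x 0 ^ 2 + x 1 ^ 2) / (2 * η)) -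
        (y 0 * (x 0 + s) + y 1 * (x 1 - s) - ((x 0 + s) ^ 2 + (x 1 - s) ^ 2) / (2 * η))) := by
    field_simp
    ring
  have := mul_nonneg hη.le (sub_nonneg.2 hz)
  linarith

/-- First-order optimality condition at a fully mixed maximizer. -/
theorem IsGDArgmax.sub_eq_of_pos {η : ℝ} (hη : 0 < η) {y x : Fin 2 → ℝ} (h : IsGDArgmax η y x)
    (hx0 : 0 < x 0) (hx1 : 0 < x 1) : x 0 - x 1 = η * (y 0 - y 1) := by
  have hp := fun s => h.perturb_le hη (s := s)
  generalize hD : η * (y 0 - y 1) - (x 0 - x 1) = D at hp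
  suffices D = 0 by linarith
  rcases lt_trichotomy D 0 with hneg | hzero | hpos
  · have hm : 0 < min (x 0) (-D / 2) := lt_min hx0 (by linarith)
    have h1 := hp (-min (x 0) (-D / 2)) (by linarith [min_le_left (x 0) (-D / 2)]) (by linarith)
    nlinarith [min_le_right (x 0) (-D / 2)]
  · exact hzero
  · have hm : 0 < min (x 1) (D / 2) := lt_min hx1 (by linarith)
    have h1 := hp (min (x 1) (D / 2)) (by linarith) (min_le_left _ _)
    nlinarith [min_le_right (x 1) (D / 2)]

/-- The conjugate of the regularizer at a payoff vector whose maximizer is fully mixed. -/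
theorem hstar_eq_of_pos {η : ℝ} (hη : 0 < η) {y x : Fin 2 → ℝ} (h : IsGDArgmax η y x)
    (hx0 : 0 < x 0) (hx1 : 0 < x 1) :
    hstar η y = (y 0 + y 1) / 2 + η / 4 * (y 0 - y 1) ^ 2 - 1 / (4 * η) := by
  have hd := h.sub_eq_of_pos hη hx0 hx1
  have hsum := h.1.2.2
  have e0 : x 0 = (1 + η * (y 0 - y 1)) / 2 := by linarith
  have e1 : x 1 = (1 - η * (y 0 - y 1)) / 2 := by linarith
  rw [hstar_eq_of_isGDArgmax h, gdObj, dot2, e0, e1]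
  field_simp
  ring

/-- if player 1 plays `(1,0)` at iterations `t` and `t+1` while player 2's
strategies are fully mixed at both iterations, the energy increases by exactly
`(η/4)(a−b)²`. -/
theorem energy_increase_mixed (a b c d : ℝ) (A : Matrix (Fin 2) (Fin 2) ℝ)
    (hA : A = !![a, b; c, d])
    (η : ℝ) (hη : 0 < η) (y10 y20 : Fin 2 → ℝ) (g : GD2 A η y10 y20) (t : ℕ)
    (h1 : g.x1 t = ![1, 0]) (h1' : g.x1 (t + 1) = ![1, 0])
    (h2 : 0 < g.x2 t 0 ∧ 0 < g.x2 t 1)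
    (h2' : 0 < g.x2 (t + 1) 0 ∧ 0 < g.x2 (t + 1) 1) :
    (hstar η (g.y1 (t + 1)) + hstar η (g.y2 (t + 1))) -
      (hstar η (g.y1 t) + hstar η (g.y2 t)) = η / 4 * (a - b) ^ 2 := by
  subst hA
  have hd := (g.x2_argmax t).sub_eq_of_pos hη h2.1 h2.2
  have hsum := (g.x2_argmax t).1.2.2
  have e0 : g.x2 t 0 = (1 + η * (g.y2 t 0 - g.y2 t 1)) / 2 := by linarith
  have e1 : g.x2 t 1 = (1 - η * (g.y2 t 0 - g.y2 t 1)) / 2 := by linarith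
  have hy1 : g.y1 (t + 1) 0 = g.y1 t 0 + (a * g.x2 t 0 + b * g.x2 t 1) := by
    rw [g.y1_succ]
    simp [dotProduct]
  have hy20 : g.y2 (t + 1) 0 = g.y2 t 0 - a := by
    rw [g.y2_succ, h1]
    simp
  have hy21 : g.y2 (t + 1) 1 = g.y2 t 1 - b := by
    rw [g.y2_succ, h1]
    simp
  rw [hstar_eq_of_pos hη (g.x2_argmax t) h2.1 h2.2,
    hstar_eq_of_pos hη (g.x2_argmax (t + 1)) h2'.1 h2'.2,
    hstar_eq_of_isGDArgmax (g.x1_argmax t), hstar_eq_of_isGDArgmax (g.x1_argmax (t + 1)),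
    h1, h1', hy20, hy21]
  simp only [gdObj, dot2, Matrix.cons_val_zero, Matrix.cons_val_one, hy1, e0, e1]
  ring
end

section
/- Let n₁, n₂ ≥ 1 and A ∈ ℝ^{n₁×n₂}, and run gradient descent in the zero-sum game A with any step size η > 0 and any initial payoff vectors. Then the energy is non-decreasing: Eᵗ⁺¹ ≥ Eᵗ for all t ≥ 0. -/
open Finset

/-- Convex conjugate of the regularizer. -/
noncomputable def hstarN {n : ℕ} (η : ℝ) (y : Fin n → ℝ) : ℝ :=
  sSup (gdObjN η y '' simplexN n)

/-- Gradient descent dynamics in the zero-sum game `A : ℝ^{n₁×n₂}`. -/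
structure GDN (n1 n2 : ℕ) (A : Matrix (Fin n1) (Fin n2) ℝ) (η : ℝ)
    (y10 : Fin n1 → ℝ) (y20 : Fin n2 → ℝ) where
  x1 : ℕ → Fin n1 → ℝ
  x2 : ℕ → Fin n2 → ℝ
  y1 : ℕ → Fin n1 → ℝ
  y2 : ℕ → Fin n2 → ℝ
  y1_zero : y1 0 = y10
  y2_zero : y2 0 = y20
  x1_argmax : ∀ t, IsGDArgmaxN η (y1 t) (x1 t)
  x2_argmax : ∀ t, IsGDArgmaxN η (y2 t) (x2 t)
  y1_succ : ∀ t, y1 (t + 1) = y1 t + A.mulVec (x2 t)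
  y2_succ : ∀ t, y2 (t + 1) = y2 t - A.transpose.mulVec (x1 t)

theorem hstarN_eq_of_isGDArgmaxN {n : ℕ} {η : ℝ} {y x : Fin n → ℝ} (h : IsGDArgmaxN η y x) :
    hstarN η y = gdObjN η y x := by
  apply IsGreatest.csSup_eq
  refine ⟨⟨x, h.1, rfl⟩, ?_⟩
  rintro _ ⟨z, hz, rfl⟩
  exact h.2 z hz

theorem gdObjN_add {n : ℕ} (η : ℝ) (y v x : Fin n → ℝ) :
    gdObjN η (y + v) x = gdObjN η y x + v ⬝ᵥ x := by
  simp only [gdObjN, dotN, dotProduct, Pi.add_apply, add_mul, Finset.sum_add_distrib]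
  ring

/-- Subgradient inequality for `hstarN` at a point whose maximizer is `x`; the maximum at the
perturbed point is assumed to be attained at `z`. -/
theorem hstarN_add_dotProduct_le {n : ℕ} {η : ℝ} {y v x z : Fin n → ℝ}
    (h : IsGDArgmaxN η y x) (hz : IsGDArgmaxN η (y + v) z) :
    hstarN η y + v ⬝ᵥ x ≤ hstarN η (y + v) := by
  rw [hstarN_eq_of_isGDArgmaxN h, hstarN_eq_of_isGDArgmaxN hz, ← gdObjN_add]
  exact hz.2 x h.1

/-- the energy is non-decreasing along gradient descent dynamics in any
zero-sum game. -/
theorem energy_nondecreasing (n1 n2 : ℕ) (hn1 : 1 ≤ n1) (hn2 : 1 ≤ n2)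
    (A : Matrix (Fin n1) (Fin n2) ℝ) (η : ℝ) (hη : 0 < η)
    (y10 : Fin n1 → ℝ) (y20 : Fin n2 → ℝ) (g : GDN n1 n2 A η y10 y20) :
    ∀ t : ℕ, hstarN η (g.y1 t) + hstarN η (g.y2 t) ≤
      hstarN η (g.y1 (t + 1)) + hstarN η (g.y2 (t + 1)) := by
  intro t
  have m1 := g.x1_argmax (t + 1)
  have m2 := g.x2_argmax (t + 1)
  rw [g.y1_succ] at m1 ⊢
  rw [g.y2_succ, sub_eq_add_neg] at m2 ⊢
  have h1 := hstarN_add_dotProduct_le (g.x1_argmax t) m1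
  have h2 := hstarN_add_dotProduct_le (g.x2_argmax t) m2
  have cancel : A.mulVec (g.x2 t) ⬝ᵥ g.x1 t = A.transpose.mulVec (g.x1 t) ⬝ᵥ g.x2 t := by
    rw [Matrix.mulVec_transpose, ← Matrix.dotProduct_mulVec, dotProduct_comm]
  rw [neg_dotProduct] at h2
  linarith
end

section
/- Consider Matching Pennies with step size η = 1 and initial payoff vectors y₁⁰ = y₂⁰ = (1, 0), with both players updating by gradient descent. For every n ≥ 0 and k ∈ {0, …, n}, at iteration t = n(n+1)/2 + k the payoff vectors are: y₁ᵗ = (1+k, −k) if n ≡ 0 (mod 4); y₁ᵗ = (1+n−k, −n+k) if n ≡ 1 (mod 4); y₁ᵗ = (−k, 1+k) if n ≡ 2 (mod 4); y₁ᵗ = (−n+k, 1+n−k) if n ≡ 3 (mod 4); and y₂ᵗ = (1+n−k, −n+k) if n ≡ 0 (mod 4); y₂ᵗ = (−k, 1+k) if n ≡ 1 (mod 4); y₂ᵗ = (−n+k, 1+n−k) if n ≡ 2 (mod 4); y₂ᵗ = (1+k, −k) if n ≡ 3 (mod 4). -/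
open Finset

/-- If the first payoff exceeds the second by at least `1`, the maximizer for step size `1` is the
first pure strategy. -/
lemma IsGDArgmax.eq_first {y x : Fin 2 → ℝ} (h : IsGDArgmax 1 y x) (hy : y 1 + 1 ≤ y 0) :
    x 0 = 1 ∧ x 1 = 0 := by
  obtain ⟨⟨-, h1, hs⟩, hmax⟩ := h
  have hz := hmax ![1, 0] ⟨by simp, by simp, by simp⟩
  simp only [gdObj, dot2, Matrix.cons_val_zero, Matrix.cons_val_one] at hz
  have hx : x 0 = 1 - x 1 := by linarith
  rw [hx] at hz
  have : x 1 = 0 := by nlinarith [mul_nonneg h1 (sub_nonneg.2 hy)]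
  exact ⟨by linarith, this⟩

/-- If the second payoff exceeds the first by at least `1`, the maximizer for step size `1` is the
second pure strategy. -/
lemma IsGDArgmax.eq_second {y x : Fin 2 → ℝ} (h : IsGDArgmax 1 y x) (hy : y 0 + 1 ≤ y 1) :
    x 0 = 0 ∧ x 1 = 1 := by
  obtain ⟨⟨h0, -, hs⟩, hmax⟩ := h
  have hz := hmax ![0, 1] ⟨by simp, by simp, by simp⟩
  simp only [gdObj, dot2, Matrix.cons_val_zero, Matrix.cons_val_one] at hz
  have hx : x 1 = 1 - x 0 := by linarith
  rw [hx] at hz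
  have : x 0 = 0 := by nlinarith [mul_nonneg h0 (sub_nonneg.2 hy)]
  exact ⟨this, by linarith⟩

namespace GD2

variable {y10 y20 : Fin 2 → ℝ} (g : GD2 !![(1 : ℝ), -1; -1, 1] 1 y10 y20) {t : ℕ} {a b c d : ℝ}

lemma y1_succ_of_first (h1 : g.y1 t = ![a, b]) (h2 : g.y2 t = ![c, d]) (h : d + 1 ≤ c) :
    g.y1 (t + 1) = ![a + 1, b - 1] := by
  obtain ⟨hx0, hx1⟩ := (g.x2_argmax t).eq_first (by simpa [h2] using h)
  rw [g.y1_succ, h1]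
  ext i
  fin_cases i <;> simp [dotProduct, hx0, hx1, sub_eq_add_neg]

lemma y1_succ_of_second (h1 : g.y1 t = ![a, b]) (h2 : g.y2 t = ![c, d]) (h : c + 1 ≤ d) :
    g.y1 (t + 1) = ![a - 1, b + 1] := by
  obtain ⟨hx0, hx1⟩ := (g.x2_argmax t).eq_second (by simpa [h2] using h)
  rw [g.y1_succ, h1]
  ext i
  fin_cases i <;> simp [dotProduct, hx0, hx1, sub_eq_add_neg]

lemma y2_succ_of_first (h1 : g.y1 t = ![a, b]) (h2 : g.y2 t = ![c, d]) (h : b + 1 ≤ a) :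
    g.y2 (t + 1) = ![c - 1, d + 1] := by
  obtain ⟨hx0, hx1⟩ := (g.x1_argmax t).eq_first (by simpa [h1] using h)
  rw [g.y2_succ, h2]
  ext i
  fin_cases i <;> simp [hx0, hx1]

lemma y2_succ_of_second (h1 : g.y1 t = ![a, b]) (h2 : g.y2 t = ![c, d]) (h : a + 1 ≤ b) :
    g.y2 (t + 1) = ![c + 1, d - 1] := by
  obtain ⟨hx0, hx1⟩ := (g.x1_argmax t).eq_second (by simpa [h1] using h)
  rw [g.y2_succ, h2]
  ext i
  fin_cases i <;> simp [hx0, hx1]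

end GD2

/-- exact positions of the payoff vectors in Matching Pennies with
`η = 1` and `y₁⁰ = y₂⁰ = (1,0)`. -/
theorem matching_pennies_payoff_positions
    (g : GD2 !![(1 : ℝ), -1; -1, 1] 1 ![1, 0] ![1, 0])
    (n k : ℕ) (hk : k ≤ n) :
    (n % 4 = 0 → g.y1 (n * (n + 1) / 2 + k) = ![1 + (k : ℝ), -(k : ℝ)] ∧
      g.y2 (n * (n + 1) / 2 + k) = ![1 + (n : ℝ) - (k : ℝ), -(n : ℝ) + (k : ℝ)]) ∧
    (n % 4 = 1 → g.y1 (n * (n + 1) / 2 + k) = ![1 + (n : ℝ) - (k : ℝ), -(n : ℝ) + (k : ℝ)] ∧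
      g.y2 (n * (n + 1) / 2 + k) = ![-(k : ℝ), 1 + (k : ℝ)]) ∧
    (n % 4 = 2 → g.y1 (n * (n + 1) / 2 + k) = ![-(k : ℝ), 1 + (k : ℝ)] ∧
      g.y2 (n * (n + 1) / 2 + k) = ![-(n : ℝ) + (k : ℝ), 1 + (n : ℝ) - (k : ℝ)]) ∧
    (n % 4 = 3 → g.y1 (n * (n + 1) / 2 + k) = ![-(n : ℝ) + (k : ℝ), 1 + (n : ℝ) - (k : ℝ)] ∧
      g.y2 (n * (n + 1) / 2 + k) = ![1 + (k : ℝ), -(k : ℝ)]) := by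
  induction n generalizing k with
  | zero =>
    obtain rfl : k = 0 := by omega
    simp [g.y1_zero, g.y2_zero]
  | succ n ihn =>
    induction k with
    | zero =>
      have ht : (n + 1) * (n + 1 + 1) / 2 + 0 = n * (n + 1) / 2 + n + 1 := by
        rw [show (n + 1) * (n + 1 + 1) = n * (n + 1) + (n + 1) * 2 by ring,
          Nat.add_mul_div_right _ _ two_pos]
        ring
      have ih := ihn n le_rfl
      have hn0 : (0 : ℝ) ≤ n := n.cast_nonneg
      rw [ht]
      refine ⟨fun hn => ?_, fun hn => ?_, fun hn => ?_, fun hn => ?_⟩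
      · obtain ⟨h1, h2⟩ := ih.2.2.2 (by omega)
        rw [g.y1_succ_of_first h1 h2 (by linarith), g.y2_succ_of_second h1 h2 (by linarith)]
        refine ⟨Matrix.vec2_eq ?_ ?_, Matrix.vec2_eq ?_ ?_⟩ <;> push_cast <;> ring
      · obtain ⟨h1, h2⟩ := ih.1 (by omega)
        rw [g.y1_succ_of_first h1 h2 (by linarith), g.y2_succ_of_first h1 h2 (by linarith)]
        refine ⟨Matrix.vec2_eq ?_ ?_, Matrix.vec2_eq ?_ ?_⟩ <;> push_cast <;> ring
      · obtain ⟨h1, h2⟩ := ih.2.1 (by omega)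
        rw [g.y1_succ_of_second h1 h2 (by linarith), g.y2_succ_of_first h1 h2 (by linarith)]
        refine ⟨Matrix.vec2_eq ?_ ?_, Matrix.vec2_eq ?_ ?_⟩ <;> push_cast <;> ring
      · obtain ⟨h1, h2⟩ := ih.2.2.1 (by omega)
        rw [g.y1_succ_of_second h1 h2 (by linarith), g.y2_succ_of_second h1 h2 (by linarith)]
        refine ⟨Matrix.vec2_eq ?_ ?_, Matrix.vec2_eq ?_ ?_⟩ <;> push_cast <;> ring
    | succ k ihk =>
      have ih := ihk (by omega)
      have hkn : (k : ℝ) + 1 ≤ n + 1 := by exact_mod_cast hk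
      have hk0 : (0 : ℝ) ≤ k := k.cast_nonneg
      push_cast at ih
      rw [← add_assoc]
      refine ⟨fun hn => ?_, fun hn => ?_, fun hn => ?_, fun hn => ?_⟩
      · obtain ⟨h1, h2⟩ := ih.1 (by omega)
        rw [g.y1_succ_of_first h1 h2 (by linarith), g.y2_succ_of_first h1 h2 (by linarith)]
        refine ⟨Matrix.vec2_eq ?_ ?_, Matrix.vec2_eq ?_ ?_⟩ <;> push_cast <;> ring
      · obtain ⟨h1, h2⟩ := ih.2.1 (by omega)
        rw [g.y1_succ_of_second h1 h2 (by linarith), g.y2_succ_of_first h1 h2 (by linarith)]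
        refine ⟨Matrix.vec2_eq ?_ ?_, Matrix.vec2_eq ?_ ?_⟩ <;> push_cast <;> ring
      · obtain ⟨h1, h2⟩ := ih.2.2.1 (by omega)
        rw [g.y1_succ_of_second h1 h2 (by linarith), g.y2_succ_of_second h1 h2 (by linarith)]
        refine ⟨Matrix.vec2_eq ?_ ?_, Matrix.vec2_eq ?_ ?_⟩ <;> push_cast <;> ring
      · obtain ⟨h1, h2⟩ := ih.2.2.2 (by omega)
        rw [g.y1_succ_of_first h1 h2 (by linarith), g.y2_succ_of_second h1 h2 (by linarith)]
        refine ⟨Matrix.vec2_eq ?_ ?_, Matrix.vec2_eq ?_ ?_⟩ <;> push_cast <;> ring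
end

section
/- Consider Matching Pennies with step size η = 1 and initial payoff vectors y₁⁰ = y₂⁰ = (1, 0), with both players updating by gradient descent. For every n ≥ 0 and k ∈ {0, …, n}, at iteration t = n(n+1)/2 + k player 1's cumulative utility satisfies: Σ_{s=0}^{t} x₁ˢ·A x₂ˢ = 1 − n/2 + k if n is even, and Σ_{s=0}^{t} x₁ˢ·A x₂ˢ = (n−1)/2 − k if n is odd. -/
open Finset

/-- The difference of the two coordinates of a vector. -/
def coordGap (x : Fin 2 → ℝ) : ℝ := x 0 - x 1

theorem IsGDArgmax.coordGap_eq_one {y x : Fin 2 → ℝ} (h : IsGDArgmax 1 y x)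
    (hy : 1 ≤ coordGap y) : coordGap x = 1 := by
  obtain ⟨⟨-, h1, hsum⟩, hmax⟩ := h
  have hz := hmax ![1, 0] (by simp [simplex2])
  simp only [gdObj, dot2, Matrix.cons_val_zero, Matrix.cons_val_one] at hz
  unfold coordGap at *
  have hx0 : x 0 = 1 - x 1 := by linarith
  rw [hx0] at hz ⊢
  have hx1 : x 1 = 0 := by
    have : x 1 ^ 2 ≤ 0 := by nlinarith [mul_nonneg h1 (sub_nonneg.mpr hy)]
    exact pow_eq_zero_iff two_ne_zero |>.mp (le_antisymm this (sq_nonneg _))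
  rw [hx1]; ring

theorem IsGDArgmax.coordGap_eq_neg_one {y x : Fin 2 → ℝ} (h : IsGDArgmax 1 y x)
    (hy : coordGap y ≤ -1) : coordGap x = -1 := by
  obtain ⟨⟨h0, -, hsum⟩, hmax⟩ := h
  have hz := hmax ![0, 1] (by simp [simplex2])
  simp only [gdObj, dot2, Matrix.cons_val_zero, Matrix.cons_val_one] at hz
  unfold coordGap at *
  have hx1 : x 1 = 1 - x 0 := by linarith
  rw [hx1] at hz ⊢
  have hx0 : x 0 = 0 := by
    have : x 0 ^ 2 ≤ 0 := by nlinarith [mul_nonneg h0 (sub_nonneg.mpr hy)]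
    exact pow_eq_zero_iff two_ne_zero |>.mp (le_antisymm this (sq_nonneg _))
  rw [hx0]; ring

/-- When the payoff gap has sign `a` and size at least `1`, the maximizer is the corresponding
pure strategy. -/
theorem IsGDArgmax.coordGap_eq_sign {y x : Fin 2 → ℝ} (h : IsGDArgmax 1 y x) {a : ℝ}
    (ha : a = 1 ∨ a = -1) (hy : 1 ≤ a * coordGap y) : coordGap x = a := by
  rcases ha with rfl | rfl
  · exact h.coordGap_eq_one (by linarith)
  · exact h.coordGap_eq_neg_one (by linarith)

theorem dot2_matchingPennies (x z : Fin 2 → ℝ) :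
    dot2 x ((!![(1 : ℝ), -1; -1, 1]).mulVec z) = coordGap x * coordGap z := by
  simp [dot2, coordGap, dotProduct, Fin.sum_univ_two]
  ring

namespace GD2

variable {u v : Fin 2 → ℝ} (g : GD2 !![(1 : ℝ), -1; -1, 1] 1 u v)

theorem coordGap_y1_succ (t : ℕ) :
    coordGap (g.y1 (t + 1)) = coordGap (g.y1 t) + 2 * coordGap (g.x2 t) := by
  rw [g.y1_succ]
  simp [coordGap, dotProduct, Fin.sum_univ_two]
  ring

theorem coordGap_y2_succ (t : ℕ) :
    coordGap (g.y2 (t + 1)) = coordGap (g.y2 t) - 2 * coordGap (g.x1 t) := by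
  rw [g.y2_succ]
  simp [coordGap]
  ring

/-- Player 1's cumulative utility over the first `t` iterations. -/
noncomputable def cumUtility (t : ℕ) : ℝ :=
  ∑ s ∈ Finset.range t, dot2 (g.x1 s) ((!![(1 : ℝ), -1; -1, 1]).mulVec (g.x2 s))

/-- While both payoff gaps keep their signs `a` and `b`, the dynamics are affine in time. -/
theorem affine_of_signs {a b : ℝ} (ha : a = 1 ∨ a = -1) (hb : b = 1 ∨ b = -1) (t k : ℕ)
    (h : ∀ i < k, 1 ≤ a * (coordGap (g.y1 t) + 2 * b * i) ∧
      1 ≤ b * (coordGap (g.y2 t) - 2 * a * i)) :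
    coordGap (g.y1 (t + k)) = coordGap (g.y1 t) + 2 * b * k ∧
    coordGap (g.y2 (t + k)) = coordGap (g.y2 t) - 2 * a * k ∧
    g.cumUtility (t + k) = g.cumUtility t + a * b * k := by
  induction k with
  | zero => simp
  | succ k ih =>
    obtain ⟨h1, h2, h3⟩ := ih fun i hi => h i (by omega)
    obtain ⟨hs1, hs2⟩ := h k (by omega)
    rw [← h1] at hs1
    rw [← h2] at hs2
    have e1 := (g.x1_argmax _).coordGap_eq_sign ha hs1
    have e2 := (g.x2_argmax _).coordGap_eq_sign hb hs2
    have h4 : g.cumUtility (t + k + 1) = g.cumUtility (t + k) + a * b := by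
      rw [cumUtility, Finset.sum_range_succ, dot2_matchingPennies, e1, e2, cumUtility]
    rw [← add_assoc, coordGap_y1_succ, coordGap_y2_succ, h4, e1, e2, h1, h2, h3]
    push_cast
    refine ⟨by ring, by ring, by ring⟩

theorem run_same_sign {ε : ℝ} (hε : ε = 1 ∨ ε = -1) {t n k : ℕ} (hk : k ≤ n + 1)
    (h1 : coordGap (g.y1 t) = ε) (h2 : coordGap (g.y2 t) = ε * (2 * n + 1)) :
    coordGap (g.y1 (t + k)) = ε * (1 + 2 * k) ∧
    coordGap (g.y2 (t + k)) = ε * (2 * n + 1 - 2 * k) ∧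
    g.cumUtility (t + k) = g.cumUtility t + k := by
  have hsq : ε * ε = 1 := by rcases hε with rfl | rfl <;> norm_num
  obtain ⟨r1, r2, r3⟩ := g.affine_of_signs hε hε t k fun i hi => by
    have hi' : (i : ℝ) ≤ n := by exact_mod_cast (by omega : i ≤ n)
    have : (0 : ℝ) ≤ i := i.cast_nonneg
    rw [h1, h2]
    constructor
    · linear_combination 2 * this - (1 + 2 * (i : ℝ)) * hsq
    · linear_combination 2 * hi' - (2 * (n : ℝ) + 1 - 2 * i) * hsq
  rw [r1, r2, r3, h1, h2, hsq]
  refine ⟨by ring, by ring, by ring⟩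

theorem run_opposite_sign {ε : ℝ} (hε : ε = 1 ∨ ε = -1) {t n k : ℕ} (hk : k ≤ n + 1)
    (h1 : coordGap (g.y1 t) = ε * (2 * n + 1)) (h2 : coordGap (g.y2 t) = -ε) :
    coordGap (g.y1 (t + k)) = ε * (2 * n + 1 - 2 * k) ∧
    coordGap (g.y2 (t + k)) = -ε * (1 + 2 * k) ∧
    g.cumUtility (t + k) = g.cumUtility t - k := by
  have hsq : ε * ε = 1 := by rcases hε with rfl | rfl <;> norm_num
  have hε' : -ε = 1 ∨ -ε = -1 := by rcases hε with rfl | rfl <;> norm_num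
  obtain ⟨r1, r2, r3⟩ := g.affine_of_signs hε hε' t k fun i hi => by
    have hi' : (i : ℝ) ≤ n := by exact_mod_cast (by omega : i ≤ n)
    have : (0 : ℝ) ≤ i := i.cast_nonneg
    rw [h1, h2]
    constructor
    · linear_combination 2 * hi' - (2 * (n : ℝ) + 1 - 2 * i) * hsq
    · linear_combination 2 * this - (1 + 2 * (i : ℝ)) * hsq
  rw [r1, r2, r3, h1, h2]
  refine ⟨by ring, by ring, by linear_combination -(k : ℝ) * hsq⟩

theorem odd_block_start {ε : ℝ} (hε : ε = 1 ∨ ε = -1) {j : ℕ}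
    (h1 : coordGap (g.y1 (j * (2 * j + 1))) = ε)
    (h2 : coordGap (g.y2 (j * (2 * j + 1))) = ε * (4 * j + 1))
    (h3 : g.cumUtility (j * (2 * j + 1)) = -j) :
    coordGap (g.y1 ((2 * j + 1) * (j + 1))) = ε * (4 * j + 3) ∧
    coordGap (g.y2 ((2 * j + 1) * (j + 1))) = -ε ∧
    g.cumUtility ((2 * j + 1) * (j + 1)) = j + 1 := by
  obtain ⟨r1, r2, r3⟩ := g.run_same_sign hε (n := 2 * j) le_rfl h1
    (by rw [h2]; push_cast; ring)
  have ht : (2 * j + 1) * (j + 1) = j * (2 * j + 1) + (2 * j + 1) := by ring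
  rw [ht, r1, r2, r3, h3]
  push_cast
  refine ⟨by ring, by ring, by ring⟩

end GD2

theorem GD2.even_block_start (g : GD2 !![(1 : ℝ), -1; -1, 1] 1 ![1, 0] ![1, 0]) (j : ℕ) :
    ∃ ε : ℝ, (ε = 1 ∨ ε = -1) ∧ coordGap (g.y1 (j * (2 * j + 1))) = ε ∧
      coordGap (g.y2 (j * (2 * j + 1))) = ε * (4 * j + 1) ∧
      g.cumUtility (j * (2 * j + 1)) = -j := by
  induction j with
  | zero => exact ⟨1, by simp [g.y1_zero, g.y2_zero, coordGap, cumUtility]⟩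
  | succ j ih =>
    obtain ⟨ε, hε, h1, h2, h3⟩ := ih
    obtain ⟨o1, o2, o3⟩ := g.odd_block_start hε h1 h2 h3
    obtain ⟨r1, r2, r3⟩ := g.run_opposite_sign hε (n := 2 * j + 1) le_rfl
      (by rw [o1]; push_cast; ring) o2
    have ht : (j + 1) * (2 * (j + 1) + 1) = (2 * j + 1) * (j + 1) + (2 * j + 1 + 1) := by ring
    refine ⟨-ε, by rcases hε with rfl | rfl <;> norm_num, ?_⟩
    rw [ht, r1, r2, r3, o3]
    push_cast
    refine ⟨by ring, by ring, by ring⟩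

/-- exact cumulative utility of player 1 in Matching Pennies with `η = 1`
and `y₁⁰ = y₂⁰ = (1,0)`. -/
theorem matching_pennies_cumulative_utility
    (g : GD2 !![(1 : ℝ), -1; -1, 1] 1 ![1, 0] ![1, 0])
    (n k : ℕ) (hk : k ≤ n) :
    (Even n → ∑ s ∈ Finset.range (n * (n + 1) / 2 + k + 1),
        dot2 (g.x1 s) ((!![(1 : ℝ), -1; -1, 1]).mulVec (g.x2 s)) =
        1 - (n : ℝ) / 2 + (k : ℝ)) ∧
    (Odd n → ∑ s ∈ Finset.range (n * (n + 1) / 2 + k + 1),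
        dot2 (g.x1 s) ((!![(1 : ℝ), -1; -1, 1]).mulVec (g.x2 s)) =
        ((n : ℝ) - 1) / 2 - (k : ℝ)) := by
  constructor
  · intro hn
    obtain ⟨j, rfl⟩ := hn.exists_two_nsmul
    rw [smul_eq_mul] at hk ⊢
    obtain ⟨ε, hε, h1, h2, h3⟩ := g.even_block_start j
    obtain ⟨-, -, r⟩ := g.run_same_sign hε (n := 2 * j) (k := k + 1) (by omega) h1
      (by rw [h2]; push_cast; ring)
    have ht : 2 * j * (2 * j + 1) / 2 = j * (2 * j + 1) := by
      rw [mul_assoc, Nat.mul_div_cancel_left _ two_pos]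
    rw [ht, add_assoc]
    refine r.trans ?_
    rw [h3]
    push_cast
    ring
  · rintro ⟨j, rfl⟩
    obtain ⟨ε, hε, h1, h2, h3⟩ := g.even_block_start j
    obtain ⟨o1, o2, o3⟩ := g.odd_block_start hε h1 h2 h3
    obtain ⟨-, -, r⟩ := g.run_opposite_sign hε (n := 2 * j + 1) (k := k + 1) (by omega)
      (by rw [o1]; push_cast; ring) o2
    have ht : (2 * j + 1) * (2 * j + 1 + 1) / 2 = (2 * j + 1) * (j + 1) := by
      rw [show (2 * j + 1) * (2 * j + 1 + 1) = 2 * ((2 * j + 1) * (j + 1)) by ring,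
        Nat.mul_div_cancel_left _ two_pos]
    rw [ht, add_assoc]
    refine r.trans ?_
    rw [o3]
    push_cast
    ring
end

section
/- Consider Matching Pennies with step size η = 1 and initial payoff vectors y₁⁰ = y₂⁰ = (1, 0), with both players updating by gradient descent. Then for every t ≥ 0, the value of the best fixed strategy with hindsight for player 1 satisfies max_{x ∈ Δ} Σ_{s=0}^{t} x·A x₂ˢ = |y₁₁ᵗ⁺¹ − 1|, where y₁₁ᵗ⁺¹ is the first coordinate of player 1's payoff vector at iteration t + 1. -/
open Finset

/-- Cumulative payoff vectors are the initial vector plus the sum of all payoffs received. -/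
theorem GD2.y1_eq_add_sum {A : Matrix (Fin 2) (Fin 2) ℝ} {η : ℝ} {y10 y20 : Fin 2 → ℝ}
    (g : GD2 A η y10 y20) (t : ℕ) :
    g.y1 t = y10 + ∑ s ∈ range t, A.mulVec (g.x2 s) := by
  induction t with
  | zero => simp [g.y1_zero]
  | succ t ih => rw [g.y1_succ, ih, sum_range_succ, add_assoc]

theorem sum_dot2 {ι : Type*} (S : Finset ι) (x : Fin 2 → ℝ) (v : ι → Fin 2 → ℝ) :
    ∑ s ∈ S, dot2 x (v s) = dot2 x (∑ s ∈ S, v s) := by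
  simp [dot2, sum_add_distrib, mul_sum]

/-- The support function of the simplex at the antisymmetric vector `(c, -c)` is `|c|`. -/
theorem isGreatest_dot2_simplex2 {w : Fin 2 → ℝ} (hw : w 1 = -w 0) :
    IsGreatest ((fun x => dot2 x w) '' simplex2) |w 0| := by
  constructor
  · rcases le_total 0 (w 0) with h | h
    · exact ⟨![1, 0], by simp [simplex2], by simp [dot2, abs_of_nonneg h]⟩
    · exact ⟨![0, 1], by simp [simplex2], by simp [dot2, hw, abs_of_nonpos h]⟩
  · rintro _ ⟨x, ⟨h0, h1, h⟩, rfl⟩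
    simp only [dot2, hw]
    calc x 0 * w 0 + x 1 * -w 0 ≤ x 0 * |w 0| + x 1 * |w 0| := by
          gcongr
          · exact le_abs_self _
          · exact neg_le_abs _
      _ = |w 0| := by rw [← add_mul, h, one_mul]

/-- in Matching Pennies with `η = 1` and `y₁⁰ = y₂⁰ = (1,0)`, the value of
the best fixed strategy in hindsight for player 1 equals `|y₁₁ᵗ⁺¹ − 1|`. -/
theorem matching_pennies_best_fixed
    (g : GD2 !![(1 : ℝ), -1; -1, 1] 1 ![1, 0] ![1, 0]) (t : ℕ) :
    sSup ((fun x => ∑ s ∈ Finset.range (t + 1),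
        dot2 x ((!![(1 : ℝ), -1; -1, 1]).mulVec (g.x2 s))) '' simplex2) =
      |g.y1 (t + 1) 0 - 1| := by
  simp only [sum_dot2]
  rw [(isGreatest_dot2_simplex2 _).csSup_eq, g.y1_eq_add_sum]
  · simp
  · rw [Finset.sum_apply, Finset.sum_apply, ← sum_neg_distrib]
    refine sum_congr rfl fun s _ => ?_
    simp [Matrix.mulVec, dotProduct, Fin.sum_univ_two, add_comm]
end
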